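/- arXiv:2409.10224 — 6 statements merged into one kernel-verified Lean document; each statement's English description precedes it below -/
import Mathlib

section
/- The Riemann hypothesis is true if and only if the indicator function χ_{[0,1]} of the interval [0,1] belongs to the closed linear span in L²((0,∞)) of the family of functions {x ↦ {1/(n x)} : n ∈ ℕ, n ≥ 1}, where {t} denotes the fractional part of t ∈ ℝ. -/
open MeasureTheory

lemma norm_interp_le {w : ℂ} {a δ : ℝ} (ha : 0 < a) (hw : a ≤ w.re) (h0 : 0 ≤ δ) (h1 : δ ≤ 1) :
    ‖w‖ ^ (1 - δ) * ‖w + 1‖ ^ δ ≤ ‖w + δ‖ * Real.exp (1 / a ^ 2) := by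
  have hsq := Real.geom_mean_le_arith_mean2_weighted (sub_nonneg.2 h1) h0 (sq_nonneg ‖w‖)
    (sq_nonneg ‖w + 1‖) (by ring)
  have hL : (‖w‖ ^ (1 - δ) * ‖w + 1‖ ^ δ) ^ 2 = (‖w‖ ^ 2) ^ (1 - δ) * (‖w + 1‖ ^ 2) ^ δ := by
    rw [mul_pow, ← Real.rpow_natCast, ← Real.rpow_natCast, ← Real.rpow_natCast,
      ← Real.rpow_natCast, ← Real.rpow_mul (norm_nonneg _), ← Real.rpow_mul (norm_nonneg _),
      ← Real.rpow_mul (norm_nonneg _), ← Real.rpow_mul (norm_nonneg _), mul_comm (1 - δ),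
      mul_comm δ]
  have hR : (1 - δ) * ‖w‖ ^ 2 + δ * ‖w + 1‖ ^ 2 = ‖w + δ‖ ^ 2 + δ * (1 - δ) := by
    simp only [Complex.sq_norm, Complex.normSq_apply, Complex.add_re, Complex.add_im,
      Complex.one_re, Complex.one_im, Complex.ofReal_re, Complex.ofReal_im]
    ring
  have hlow : a ^ 2 ≤ ‖w + δ‖ ^ 2 := by
    have : a ≤ ‖w + δ‖ := by
      refine le_trans ?_ (Complex.re_le_norm _)
      simp; linarith
    gcongr
  have hexp : 1 + 1 / a ^ 2 ≤ Real.exp (1 / a ^ 2) := by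
    linarith [Real.add_one_le_exp (1 / a ^ 2)]
  have hexp1 : 1 ≤ Real.exp (1 / a ^ 2) := Real.one_le_exp (by positivity)
  refine le_of_sq_le_sq ?_ (by positivity)
  rw [hL]
  refine hsq.trans ?_
  rw [hR, mul_pow]
  have : δ * (1 - δ) ≤ ‖w + δ‖ ^ 2 * (1 / a ^ 2) := by
    have : 1 ≤ ‖w + δ‖ ^ 2 * (1 / a ^ 2) := by
      rw [mul_one_div, le_div_iff₀ (by positivity)]; linarith
    nlinarith
  calc ‖w + δ‖ ^ 2 + δ * (1 - δ) ≤ ‖w + δ‖ ^ 2 * (1 + 1 / a ^ 2) := by linarith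
    _ ≤ ‖w + δ‖ ^ 2 * Real.exp (1 / a ^ 2) := by gcongr
    _ ≤ ‖w + δ‖ ^ 2 * Real.exp (1 / a ^ 2) ^ 2 := by
      gcongr
      nlinarith

lemma exists_norm_Gamma_add_le {c : ℝ} (hc : 0 < c) :
    ∃ K : ℝ, 1 ≤ K ∧ ∀ z : ℂ, c ≤ z.re → ∀ δ : ℝ, 0 ≤ δ → δ ≤ 1 →
      ‖Complex.Gamma (z + δ)‖ ≤ K * ‖Complex.Gamma z‖ * ‖z‖ ^ δ := by
  have hsum : Summable fun j : ℕ => 1 / (c + j) ^ 2 := by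
    have := (Real.summable_one_div_nat_add_rpow c 2).2 (by norm_num)
    refine this.congr fun j => ?_
    rw [abs_of_pos (by positivity), add_comm]
    norm_cast
  refine ⟨Real.exp (∑' j : ℕ, 1 / (c + j) ^ 2),
    Real.one_le_exp (tsum_nonneg fun j => by positivity),
    fun z hz δ h0 h1 => ?_⟩
  have hz0 : z ≠ 0 := by rintro rfl; simp at hz; linarith
  have hG : Complex.Gamma (z + 1) = z * Complex.Gamma z := Complex.Gamma_add_one z hz0
  have hseq : ∀ n : ℕ, 1 ≤ n → ‖Complex.GammaSeq (z + δ) n‖ ≤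
      Real.exp (∑' j : ℕ, 1 / (c + j) ^ 2) *
        (‖Complex.GammaSeq z n‖ ^ (1 - δ) * ‖Complex.GammaSeq (z + 1) n‖ ^ δ) := by
    intro n hn
    have hn0 : (0 : ℝ) < n := by exact_mod_cast hn
    have hcp : ∀ u : ℂ, ‖(n : ℂ) ^ u‖ = (n : ℝ) ^ u.re := fun u => by
      rw [← Complex.ofReal_natCast, Complex.norm_cpow_eq_rpow_re_of_pos hn0]
    have hpos : ∀ u : ℝ, 0 ≤ u → 0 < ∏ j ∈ Finset.range (n + 1), ‖z + u + j‖ := fun u hu =>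
      Finset.prod_pos fun j _ => norm_pos_iff.2 fun h => by
        have := congrArg Complex.re h
        simp at this
        have : (0 : ℝ) ≤ j := j.cast_nonneg
        linarith
    have hp0 := hpos 0 le_rfl
    have hp1 := hpos 1 zero_le_one
    have hpd := hpos δ h0
    simp only [Complex.ofReal_zero, Complex.ofReal_one, add_zero] at hp0 hp1
    have hprod : (∏ j ∈ Finset.range (n + 1), ‖z + j‖) ^ (1 - δ) *
        (∏ j ∈ Finset.range (n + 1), ‖z + 1 + j‖) ^ δ ≤
        (∏ j ∈ Finset.range (n + 1), ‖z + δ + j‖) * Real.exp (∑' j : ℕ, 1 / (c + j) ^ 2) := by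
      rw [← Real.finsetProd_rpow _ _ (fun _ _ => norm_nonneg _),
        ← Real.finsetProd_rpow _ _ (fun _ _ => norm_nonneg _), ← Finset.prod_mul_distrib]
      calc _ ≤ ∏ j ∈ Finset.range (n + 1), (‖z + δ + j‖ * Real.exp (1 / (c + j) ^ 2)) := by
            refine Finset.prod_le_prod (fun _ _ => by positivity) fun j _ => ?_
            have := norm_interp_le (w := z + j) (a := c + j) (by positivity) (by simpa using hz)
              h0 h1
            rwa [add_right_comm z j 1, add_right_comm z j δ] at this
        _ ≤ _ := by
            rw [Finset.prod_mul_distrib, ← Real.exp_sum]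
            gcongr
            exact hsum.sum_le_tsum _ fun j _ => by positivity
    simp only [Complex.GammaSeq, norm_div, norm_mul, norm_prod, hcp]
    simp only [Complex.add_re, Complex.ofReal_re, Complex.one_re]
    rw [Real.div_rpow (by positivity) (by positivity),
      Real.div_rpow (by positivity) (by positivity),
      Real.mul_rpow (by positivity) (by positivity), Real.mul_rpow (by positivity) (by positivity)]
    rw [div_mul_div_comm, mul_div_assoc', div_le_div_iff₀ hpd (by positivity)]
    have e1 : (n : ℝ) ^ (z.re + δ) * ‖(n.factorial : ℂ)‖ =
        ((n : ℝ) ^ z.re) ^ (1 - δ) * ‖(n.factorial : ℂ)‖ ^ (1 - δ) *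
          (((n : ℝ) ^ (z.re + 1)) ^ δ * ‖(n.factorial : ℂ)‖ ^ δ) := by
      rw [mul_mul_mul_comm, ← Real.rpow_add (by simp; positivity), ← Real.rpow_mul hn0.le,
        ← Real.rpow_mul hn0.le, ← Real.rpow_add hn0]
      ring_nf
      simp
    rw [e1, mul_comm (Real.exp _), mul_assoc _ (Real.exp _), mul_comm (Real.exp _)]
    gcongr
  have hlim : Filter.Tendsto (fun n : ℕ => Real.exp (∑' j : ℕ, 1 / (c + j) ^ 2) *
        (‖Complex.GammaSeq z n‖ ^ (1 - δ) * ‖Complex.GammaSeq (z + 1) n‖ ^ δ)) Filter.atTop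
      (nhds (Real.exp (∑' j : ℕ, 1 / (c + j) ^ 2) *
        (‖Complex.Gamma z‖ ^ (1 - δ) * ‖Complex.Gamma (z + 1)‖ ^ δ))) :=
    (((Complex.GammaSeq_tendsto_Gamma z).norm.rpow_const (Or.inr (by linarith))).mul
      ((Complex.GammaSeq_tendsto_Gamma (z + 1)).norm.rpow_const (Or.inr h0))).const_mul _
  have := le_of_tendsto_of_tendsto (Complex.GammaSeq_tendsto_Gamma (z + δ)).norm hlim
    (Filter.eventually_atTop.2 ⟨1, hseq⟩)
  refine this.trans_eq ?_
  have hGp : 0 < ‖Complex.Gamma z‖ :=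
    norm_pos_iff.2 (Complex.Gamma_ne_zero_of_re_pos (by linarith))
  rw [hG, norm_mul, Real.mul_rpow (norm_nonneg _) (norm_nonneg _), mul_assoc]
  congr 1
  rw [mul_comm (‖z‖ ^ δ), ← mul_assoc, ← Real.rpow_add hGp]
  simp

/-- The fractional part, cut off to `(1, ∞)`. -/
noncomputable def fractTail : ℝ → ℂ := Set.indicator (Set.Ioi 1) fun x => ((Int.fract x : ℝ) : ℂ)

/-- The function `s ↦ (s - 1) ζ(s)` on the half-plane `0 < re s`, with its pole removed. -/
noncomputable def zetaMulSub (s : ℂ) : ℂ := s - s * (s - 1) * mellin fractTail (-s)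

lemma norm_fractTail_le (x : ℝ) : ‖fractTail x‖ ≤ 1 := by
  unfold fractTail
  refine (norm_indicator_le_norm_self _ _).trans ?_
  rw [Complex.norm_real, Real.norm_of_nonneg (Int.fract_nonneg _)]
  exact (Int.fract_lt_one _).le

lemma measurable_fractTail : Measurable fractTail :=
  (Complex.measurable_ofReal.comp measurable_fract).indicator measurableSet_Ioi

lemma locallyIntegrable_fractTail : LocallyIntegrable fractTail :=
  (locallyIntegrable_const (1 : ℝ)).mono measurable_fractTail.aestronglyMeasurable
    (Filter.Eventually.of_forall fun x => by simpa using norm_fractTail_le x)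

lemma fractTail_isBigO_atTop : fractTail =O[Filter.atTop] fun x : ℝ => x ^ (-(0 : ℝ)) :=
  Asymptotics.IsBigO.of_bound 1 (Filter.Eventually.of_forall fun x => by
    simpa using norm_fractTail_le x)

lemma fractTail_isBigO_zero (b : ℝ) :
    fractTail =O[nhdsWithin 0 (Set.Ioi 0)] fun x : ℝ => x ^ (-b) := by
  refine Asymptotics.IsBigO.of_bound 1 ?_
  filter_upwards [Ioo_mem_nhdsGT (zero_lt_one' ℝ)] with x hx
  rw [fractTail, Set.indicator_of_notMem (by simpa using hx.2.le)]
  simp only [norm_zero]; positivity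

lemma mellinConvergent_fractTail {s : ℂ} (hs : s.re < 0) : MellinConvergent fractTail s :=
  mellinConvergent_of_isBigO_rpow (a := 0) (b := s.re - 1)
    (locallyIntegrable_fractTail.locallyIntegrableOn _) fractTail_isBigO_atTop hs
    (fractTail_isBigO_zero _) (by linarith)

lemma differentiableAt_mellin_fractTail {s : ℂ} (hs : s.re < 0) :
    DifferentiableAt ℂ (mellin fractTail) s :=
  mellin_differentiableAt_of_isBigO_rpow (a := 0) (b := s.re - 1)
    (locallyIntegrable_fractTail.locallyIntegrableOn _) fractTail_isBigO_atTop hs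
    (fractTail_isBigO_zero _) (by linarith)

lemma mellin_fractTail_eq_setIntegral (s : ℂ) :
    mellin fractTail (-s) =
      ∫ x in Set.Ioi (1 : ℝ), (x : ℂ) ^ (-s - 1) * (Int.fract x : ℝ) := by
  unfold mellin fractTail
  simp_rw [← Set.indicator_smul]
  rw [setIntegral_indicator measurableSet_Ioi, Set.Ioi_inter_Ioi]
  simp

lemma norm_mellin_fractTail_le {s : ℂ} (hs : 0 < s.re) : ‖mellin fractTail (-s)‖ ≤ 1 / s.re := by
  have hi : IntegrableOn (fun x : ℝ => x ^ (-s.re - 1)) (Set.Ioi 1) :=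
    integrableOn_Ioi_rpow_of_lt (by linarith) one_pos
  have hv : ∫ x in Set.Ioi (1 : ℝ), x ^ (-s.re - 1) = 1 / s.re := by
    rw [integral_Ioi_rpow_of_lt (by linarith) one_pos]; simp
  rw [mellin_fractTail_eq_setIntegral, ← hv]
  refine norm_integral_le_of_norm_le hi ?_
  filter_upwards [self_mem_ae_restrict measurableSet_Ioi] with x hx
  have hx0 : (0 : ℝ) < x := lt_trans one_pos hx
  rw [norm_mul, Complex.norm_cpow_eq_rpow_re_of_pos hx0, Complex.norm_real,
    Real.norm_of_nonneg (Int.fract_nonneg _)]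
  simpa using mul_le_of_le_one_right (Real.rpow_nonneg hx0.le _) (Int.fract_lt_one x).le

lemma differentiableOn_zetaMulSub : DifferentiableOn ℂ zetaMulSub {s | 0 < s.re} := by
  intro s hs
  have h : DifferentiableAt ℂ (fun s => mellin fractTail (-s)) s :=
    (differentiableAt_mellin_fractTail (s := -s) (by simpa using hs)).comp s differentiableAt_id.neg
  unfold zetaMulSub
  exact (by fun_prop : DifferentiableAt ℂ _ s).differentiableWithinAt

@[simp] lemma zetaMulSub_one : zetaMulSub 1 = 1 := by simp [zetaMulSub]

lemma norm_zetaMulSub_le {s : ℂ} (hs : 0 < s.re) :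
    ‖zetaMulSub s‖ ≤ ‖s‖ * (1 + ‖s - 1‖ / s.re) := by
  unfold zetaMulSub
  refine (norm_sub_le _ _).trans ?_
  rw [norm_mul, norm_mul, mul_add, mul_one, mul_assoc]
  have := norm_mellin_fractTail_le hs
  rw [div_eq_mul_one_div]
  gcongr

lemma zetaMulSub_eq_of_one_lt_re {s : ℂ} (hs : 1 < s.re) :
    zetaMulSub s = (s - 1) * riemannZeta s := by
  have hs0 : s ≠ 0 := by rintro rfl; simp at hs; linarith
  have hs1 : s - 1 ≠ 0 := by
    intro h; have := congrArg Complex.re h; simp at this; linarith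
  have h1 : riemannZeta s = s * ∫ t in Set.Ioi (1 : ℝ), (⌊t⌋₊ : ℂ) * (t : ℂ) ^ (-(s + 1)) := by
    have := LSeries_eq_mul_integral (fun _ => (1 : ℂ)) zero_le_one hs
      (LSeriesSummable_one_iff.2 hs) ?_
    · change LSeries 1 s = _ at this
      rw [LSeries_one_eq_riemannZeta hs] at this
      simpa using this
    · simp only [Finset.sum_const, Nat.card_Icc, add_tsub_cancel_right, nsmul_eq_mul, mul_one,
        Real.rpow_one]
      exact Asymptotics.IsBigO.of_bound 1 (Filter.Eventually.of_forall fun n => by simp)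
  have hI : IntegrableOn (fun x : ℝ => (x : ℂ) ^ (-s)) (Set.Ioi 1) :=
    integrableOn_Ioi_cpow_of_lt (by simpa using hs) one_pos
  have hJ : IntegrableOn (fun x : ℝ => (x : ℂ) ^ (-s - 1) * (Int.fract x : ℝ)) (Set.Ioi 1) := by
    have := mellinConvergent_fractTail (s := -s) (by simp; linarith)
    refine (this.mono_set (Set.Ioi_subset_Ioi zero_le_one)).congr_fun (fun x hx => ?_)
      measurableSet_Ioi
    simp [fractTail, Set.indicator_of_mem hx]
  have h2 : ∫ t in Set.Ioi (1 : ℝ), (⌊t⌋₊ : ℂ) * (t : ℂ) ^ (-(s + 1)) =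
      (∫ x in Set.Ioi (1 : ℝ), (x : ℂ) ^ (-s)) -
        ∫ x in Set.Ioi (1 : ℝ), (x : ℂ) ^ (-s - 1) * (Int.fract x : ℝ) := by
    rw [← integral_sub hI hJ]
    refine setIntegral_congr_fun measurableSet_Ioi fun x hx => ?_
    have hx0 : (0 : ℝ) < x := lt_trans one_pos hx
    have hx1 : (x : ℂ) ≠ 0 := by exact_mod_cast hx0.ne'
    have hf : ((Int.fract x : ℝ) : ℂ) = x - (⌊x⌋₊ : ℂ) := by
      rw [Int.fract, ← natCast_floor_eq_intCast_floor hx0.le]; push_cast; rfl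
    have hp : (x : ℂ) ^ (-s) = (x : ℂ) ^ (-s - 1) * x := by
      rw [Complex.cpow_sub _ _ hx1, Complex.cpow_one]; field_simp
    rw [hf, hp, neg_add']
    ring
  rw [integral_Ioi_cpow_of_lt (by simpa using hs) one_pos] at h2
  unfold zetaMulSub
  rw [h1, h2, mellin_fractTail_eq_setIntegral]
  have hs2 : -s + 1 ≠ 0 := by intro h; apply hs1; linear_combination -h
  simp only [Complex.ofReal_one, Complex.one_cpow]
  field_simp
  ring

lemma zetaMulSub_eq {s : ℂ} (hs : 0 < s.re) (hs1 : s ≠ 1) :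
    zetaMulSub s = (s - 1) * riemannZeta s := by
  have hU : IsOpen {s : ℂ | 0 < s.re} := isOpen_lt continuous_const Complex.continuous_re
  have hpre : IsPreconnected {s : ℂ | 0 < s.re} := (convex_halfSpace_re_gt 0).isPreconnected
  set g : ℂ → ℂ := Function.update (fun s => (s - 1) * riemannZeta s) 1 1 with hg
  have hgd : ∀ z ≠ 1, DifferentiableAt ℂ g z := fun z hz => by
    have := differentiableAt_riemannZeta hz
    refine (by fun_prop :
      DifferentiableAt ℂ (fun s => (s - 1) * riemannZeta s) z).congr_of_eventuallyEq ?_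
    filter_upwards [isOpen_ne.mem_nhds hz] with w hw
    exact Function.update_of_ne hw _ _
  have h2 : AnalyticOnNhd ℂ g {s : ℂ | 0 < s.re} := by
    intro z _
    by_cases hz : z = 1
    · subst hz
      refine Complex.analyticAt_of_differentiable_on_punctured_nhds_of_continuousAt
        (eventually_nhdsWithin_of_forall hgd) ?_
      exact continuousAt_update_same.2 riemannZeta_residue_one
    · exact DifferentiableOn.analyticAt (s := {1}ᶜ) (fun w hw => (hgd w hw).differentiableWithinAt)
        (isOpen_ne.mem_nhds hz)
  have := (differentiableOn_zetaMulSub.analyticOnNhd hU).eqOn_of_preconnected_of_eventuallyEq h2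
    hpre (z₀ := 2) (by simp) ?_ hs
  · rw [this]; exact Function.update_of_ne hs1 _ _
  filter_upwards [(isOpen_lt continuous_const Complex.continuous_re).mem_nhds
    (show (1 : ℝ) < (2 : ℂ).re by simp)] with z hz
  have hz1 : z ≠ 1 := by rintro rfl; simp at hz
  rw [zetaMulSub_eq_of_one_lt_re hz, hg, Function.update_of_ne hz1]

lemma hasMellin_fract_inv {s : ℂ} (h0 : 0 < s.re) (h1 : s.re < 1) :
    HasMellin (fun x : ℝ => ((Int.fract (1 / x) : ℝ) : ℂ)) s (-riemannZeta s / s) := by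
  have hs0 : s ≠ 0 := by rintro rfl; simp at h0
  have hs1 : s ≠ 1 := by rintro rfl; simp at h1
  have hs1' : s - 1 ≠ 0 := sub_ne_zero.2 hs1
  have hs2 : -s + 1 ≠ 0 := by intro h; apply hs1'; linear_combination -h
  have hA := hasMellin_cpow_Ioc 1 (s := -s) (by simpa using h1)
  have hB : MellinConvergent fractTail (-s) := mellinConvergent_fractTail (by simpa using h0)
  have hAB := hasMellin_add hA.1 hB
  have hae : (fun t : ℝ =>
      Set.indicator (Set.Ioc 0 1) (fun t : ℝ => (t : ℂ) ^ (1 : ℂ)) t + fractTail t)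
      =ᵐ[volume.restrict (Set.Ioi 0)] fun t => ((Int.fract t : ℝ) : ℂ) := by
    have : ∀ᵐ t : ℝ ∂(volume.restrict (Set.Ioi 0)), t ≠ 1 :=
      ae_restrict_of_ae (Measure.ae_ne volume 1)
    filter_upwards [this, self_mem_ae_restrict measurableSet_Ioi] with t ht1 ht
    have ht : (0 : ℝ) < t := ht
    rcases lt_or_gt_of_ne ht1 with h | h
    · rw [Set.indicator_of_mem (Set.mem_Ioc.2 ⟨ht, h.le⟩), fractTail,
        Set.indicator_of_notMem (by simpa using h.le),
        Int.fract_eq_self.2 ⟨ht.le, h⟩]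
      simp
    · rw [Set.indicator_of_notMem (by simp [h]), fractTail,
        Set.indicator_of_mem (Set.mem_Ioi.2 h), zero_add]
  have hF : HasMellin (fun t : ℝ => ((Int.fract t : ℝ) : ℂ)) (-s) (-riemannZeta s / s) := by
    have hval : mellin (fun t : ℝ => ((Int.fract t : ℝ) : ℂ)) (-s) =
        1 / (-s + 1) + mellin fractTail (-s) := by
      rw [← hA.2, ← hAB.2]
      unfold mellin
      refine integral_congr_ae ?_
      filter_upwards [hae] with t ht
      rw [← ht]
    refine ⟨hAB.1.congr ?_, ?_⟩
    · filter_upwards [hae] with t ht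
      rw [← ht]
    · rw [hval]
      have := zetaMulSub_eq h0 hs1
      unfold zetaMulSub at this
      field_simp
      linear_combination this
  refine ⟨?_, ?_⟩
  · have := (MellinConvergent.comp_rpow (s := s) (f := fun t : ℝ => ((Int.fract t : ℝ) : ℂ))
      (a := -1) (by norm_num)).2 (by simpa [div_neg] using hF.1)
    simpa [Real.rpow_neg_one] using this
  · rw [← hF.2, ← mellin_comp_inv]
    simp

lemma hasMellin_fract_inv_mul {s : ℂ} (h0 : 0 < s.re) (h1 : s.re < 1) {n : ℕ} (hn : 1 ≤ n) :
    HasMellin (fun x : ℝ => ((Int.fract (1 / (n * x)) : ℝ) : ℂ)) s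
      (-riemannZeta s / s * (n : ℂ) ^ (-s)) := by
  have hn0 : (0 : ℝ) < n := by exact_mod_cast hn
  have h := hasMellin_fract_inv h0 h1
  refine ⟨(MellinConvergent.comp_mul_left hn0).2 h.1, ?_⟩
  have := mellin_comp_mul_left (fun x : ℝ => ((Int.fract (1 / x) : ℝ) : ℂ)) s hn0
  rw [this, h.2, smul_eq_mul, mul_comm]
  simp

lemma norm_LSeries_le_of_le_re {f : ℕ → ℂ} (hf : ∀ n, ‖f n‖ ≤ 1) {σ : ℝ} (hσ : 1 < σ) {s : ℂ}
    (hs : σ ≤ s.re) : ‖LSeries f s‖ ≤ ∑' n : ℕ, ‖LSeries.term 1 σ n‖ := by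
  have h2 : Summable fun n => ‖LSeries.term 1 σ n‖ :=
    (LSeriesSummable_one_iff.2 (by simpa using hσ)).norm
  refine tsum_of_norm_bounded h2.hasSum fun n => ?_
  exact (LSeries.norm_term_le s (g := 1) (by simpa using hf n)).trans
    (LSeries.norm_term_le_of_re_le_re 1 (by simpa using hs) n)

lemma exists_norm_riemannZeta_bounds :
    ∃ B : ℝ, 1 ≤ B ∧ ∀ s : ℂ, 2 ≤ s.re → ‖riemannZeta s‖ ≤ B ∧ ‖riemannZeta s‖⁻¹ ≤ B := by
  refine ⟨max 1 (∑' n : ℕ, ‖LSeries.term 1 (2 : ℝ) n‖), le_max_left _ _, fun s hs => ⟨?_, ?_⟩⟩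
  · rw [← LSeries_one_eq_riemannZeta (by linarith)]
    exact (norm_LSeries_le_of_le_re (by simp) one_lt_two hs).trans (le_max_right _ _)
  · have h := ArithmeticFunction.LSeries_zeta_mul_Lseries_moebius (s := s) (by linarith)
    rw [ArithmeticFunction.LSeries_zeta_eq_riemannZeta (by linarith)] at h
    rw [← norm_inv, ← eq_inv_of_mul_eq_one_right h]
    refine (norm_LSeries_le_of_le_re (fun n => ?_) one_lt_two hs).trans (le_max_right _ _)
    rw [Complex.norm_intCast]
    exact_mod_cast ArithmeticFunction.abs_moebius_le_one

lemma exists_norm_zetaMulSub_bounds :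
    ∃ B : ℝ, 1 ≤ B ∧ ∀ s : ℂ, 2 ≤ s.re →
      ‖zetaMulSub s‖ ≤ B * ‖s - 1‖ ∧ ‖s - 1‖ ≤ B * ‖zetaMulSub s‖ := by
  obtain ⟨B, hB, h⟩ := exists_norm_riemannZeta_bounds
  refine ⟨B, hB, fun s hs => ?_⟩
  have hs1 : s ≠ 1 := by rintro rfl; norm_num at hs
  have hz : riemannZeta s ≠ 0 := riemannZeta_ne_zero_of_one_le_re (by linarith)
  rw [zetaMulSub_eq (by linarith) hs1, norm_mul]
  have := h s hs
  refine ⟨by nlinarith [norm_nonneg (s - 1)], ?_⟩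
  have h2 : 1 ≤ B * ‖riemannZeta s‖ := by
    rw [← inv_mul_cancel₀ (norm_ne_zero_iff.2 hz)]
    gcongr
    exact this.2
  nlinarith [norm_nonneg (s - 1)]

/-- A holomorphic logarithm of a zero-free function on a disc, normalised at the centre. -/
lemma exists_log_on_ball {g : ℂ → ℂ} {c : ℂ} {R : ℝ} (hR : 0 < R)
    (hg : DifferentiableOn ℂ g (Metric.ball c R)) (h0 : ∀ z ∈ Metric.ball c R, g z ≠ 0) :
    ∃ l : ℂ → ℂ, DifferentiableOn ℂ l (Metric.ball c R) ∧
      (∀ z ∈ Metric.ball c R, Complex.exp (l z) = g z) ∧ l c = Complex.log (g c) := by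
  have hc : c ∈ Metric.ball c R := Metric.mem_ball_self hR
  have hg' := hg.deriv Metric.isOpen_ball
  obtain ⟨P, hP⟩ := (hg'.div hg h0).isExactOn_ball
  refine ⟨fun z => P z - P c + Complex.log (g c), fun z hz => ?_, fun z hz => ?_, by simp⟩
  · exact (((hP z hz).differentiableAt.sub_const _).add_const _).differentiableWithinAt
  · have hd : ∀ w ∈ Metric.ball c R, HasDerivAt
        (fun w => g w * Complex.exp (-(P w - P c + Complex.log (g c)))) 0 w := fun w hw => by
      have h1 := (hg.differentiableAt (Metric.isOpen_ball.mem_nhds hw)).hasDerivAt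
      have h2 := (((hP w hw).sub_const (P c)).add_const (Complex.log (g c))).neg.cexp
      refine (h1.mul h2).congr_deriv ?_
      have := h0 w hw
      simp only [Pi.div_apply]
      field_simp
      ring
    have hconst := (convex_ball c R).is_const_of_fderivWithin_eq_zero (𝕜 := ℂ)
      (f := fun w => g w * Complex.exp (-(P w - P c + Complex.log (g c))))
      (fun w hw => (hd w hw).differentiableAt.differentiableWithinAt)
      (fun w hw => by
        rw [fderivWithin_of_isOpen Metric.isOpen_ball hw, (hd w hw).hasFDerivAt.fderiv]
        simp) hz hc
    simp only [sub_self, zero_add, Complex.exp_neg, Complex.exp_log (h0 c hc),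
      mul_inv_cancel₀ (h0 c hc)] at hconst
    exact ((mul_inv_eq_one₀ (Complex.exp_ne_zero _)).1 hconst).symm

lemma zetaMulSub_ne_zero (hz : ∀ s : ℂ, 1 / 2 < s.re → riemannZeta s ≠ 0) {s : ℂ}
    (hs : 1 / 2 < s.re) : zetaMulSub s ≠ 0 := by
  by_cases h1 : s = 1
  · simp [h1]
  · rw [zetaMulSub_eq (by linarith) h1]
    exact mul_ne_zero (sub_ne_zero.2 h1) (hz s hs)

lemma norm_zetaMulSub_le_sq {s : ℂ} {t : ℝ} (hs : 1 / 2 < s.re)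
    (h : ‖s - (2 + t * Complex.I)‖ ≤ 2) : ‖zetaMulSub s‖ ≤ (11 + 2 * |t|) ^ 2 := by
  have h1 : ‖s‖ ≤ 4 + |t| := by
    calc ‖s‖ = ‖(s - (2 + t * Complex.I)) + 2 + t * Complex.I‖ := by ring_nf
      _ ≤ ‖s - (2 + t * Complex.I)‖ + ‖(2 : ℂ)‖ + ‖t * Complex.I‖ := norm_add₃_le
      _ ≤ 4 + |t| := by simp; linarith
  have h2 : ‖s - 1‖ ≤ 5 + |t| := (norm_sub_le _ _).trans (by simp; linarith)
  refine (norm_zetaMulSub_le (by linarith)).trans ?_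
  have h3 : ‖s - 1‖ / s.re ≤ 2 * (5 + |t|) := by
    rw [div_le_iff₀ (by linarith)]
    nlinarith [abs_nonneg t]
  nlinarith [abs_nonneg t, norm_nonneg s]

lemma exists_log_zetaMulSub_bound (hz : ∀ s : ℂ, 1 / 2 < s.re → riemannZeta s ≠ 0) {η : ℝ}
    (h0 : 0 < η) (h1 : η ≤ 1 / 2) :
    ∃ C : ℝ, 0 < C ∧ ∀ t : ℝ, ∃ l : ℂ → ℂ,
      DifferentiableOn ℂ l (Metric.ball (2 + t * Complex.I) (3 / 2 - η)) ∧
      (∀ z ∈ Metric.ball (2 + t * Complex.I) (3 / 2 - η), Complex.exp (l z) = zetaMulSub z) ∧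
      ∀ z ∈ Metric.ball (2 + t * Complex.I) (3 / 2 - η), ‖l z‖ ≤ C * Real.log (11 + 2 * |t|) := by
  obtain ⟨B, hB, hb⟩ := exists_norm_zetaMulSub_bounds
  refine ⟨(4 + 2 + Real.log B + Real.pi) * (6 / η), ?_, fun t => ?_⟩
  · have := Real.log_nonneg hB; positivity
  set c : ℂ := 2 + t * Complex.I with hc
  set R : ℝ := 3 / 2 - η / 2 with hR
  set T : ℝ := 11 + 2 * |t| with hT
  have hT1 : 1 ≤ Real.log T := by
    rw [Real.le_log_iff_exp_le (by positivity)]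
    have := Real.exp_one_lt_d9
    have := abs_nonneg t
    simp only [hT]; linarith
  have hRpos : 0 < R := by simp only [hR]; linarith
  have hre : ∀ z ∈ Metric.ball c R, 1 / 2 < z.re := fun z hz => by
    have := (Complex.abs_re_le_norm (z - c)).trans_lt (mem_ball_iff_norm.1 hz)
    have := (abs_lt.1 this).1
    simp [hc] at this
    simp only [hR] at this
    linarith
  have hd : DifferentiableOn ℂ zetaMulSub (Metric.ball c R) :=
    differentiableOn_zetaMulSub.mono fun z hz => lt_trans (by norm_num) (hre z hz)
  obtain ⟨l, hld, hle, hlc⟩ := exists_log_on_ball hRpos hd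
    fun z hz' => zetaMulSub_ne_zero hz (hre z hz')
  have hsub : Metric.ball c (3 / 2 - η) ⊆ Metric.ball c R :=
    Metric.ball_subset_ball (by simp only [hR]; linarith)
  refine ⟨l, hld.mono hsub, fun z hz => hle z (hsub hz), fun z hz' => ?_⟩
  have hbd : ∀ w ∈ Metric.ball c R, (l w).re ≤ 2 * Real.log T := fun w hw => by
    have hn : ‖zetaMulSub w‖ ≤ T ^ 2 := norm_zetaMulSub_le_sq (hre w hw) (by
      have := mem_ball_iff_norm.1 hw
      simp only [hR] at this
      linarith)
    rw [← hle w hw, Complex.norm_exp] at hn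
    rw [← Real.log_exp (l w).re, ← Nat.cast_ofNat, ← Real.log_pow]
    exact Real.log_le_log (Real.exp_pos _) hn
  have hcmem : c ∈ Metric.ball c R := Metric.mem_ball_self hRpos
  have hlc' : ‖l c‖ ≤ 2 * Real.log T + Real.log B + Real.pi := by
    refine (Complex.norm_le_abs_re_add_abs_im _).trans ?_
    gcongr
    · rw [abs_le]
      have hBl := Real.log_nonneg hB
      refine ⟨?_, by linarith [hbd c hcmem]⟩
      have h2 := (hb c (by simp [hc])).2
      have h3 : 1 ≤ ‖c - 1‖ := by
        refine le_trans ?_ (Complex.re_le_norm _)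
        simp [hc]; norm_num
      rw [← hle c hcmem, Complex.norm_exp] at h2
      have : Real.log 1 ≤ Real.log (B * Real.exp (l c).re) :=
        Real.log_le_log one_pos (h3.trans h2)
      rw [Real.log_one, Real.log_mul (by positivity) (by positivity), Real.log_exp] at this
      linarith
    · rw [hlc, Complex.log_im]; exact Complex.abs_arg_le_pi _
  have hz0 : z - c ∈ Metric.ball (0 : ℂ) R := by
    rw [mem_ball_zero_iff]; exact mem_ball_iff_norm.1 (hsub hz')
  have key := Complex.borelCaratheodory (M := 2 * Real.log T) (f := fun u => l (c + u)) (R := R)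
    (z := z - c) (by linarith)
    (hld.comp (by fun_prop) fun u hu => by simpa [mem_ball_iff_norm] using hu)
    (fun u hu => hbd _ (by simpa [mem_ball_iff_norm] using hu)) hRpos hz0
  simp only [add_sub_cancel, add_zero] at key
  have hzc : ‖z - c‖ < 3 / 2 - η := mem_ball_iff_norm.1 hz'
  have hden : η / 2 ≤ R - ‖z - c‖ := by simp only [hR]; linarith
  have hnn := norm_nonneg (z - c)
  have hlcn := norm_nonneg (l c)
  refine key.trans ?_
  rw [← add_div, div_le_iff₀ (by linarith)]
  have hBl := Real.log_nonneg hB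
  have hpi := Real.pi_pos
  have h4 : 2 * (2 * Real.log T) * ‖z - c‖ + ‖l c‖ * (R + ‖z - c‖) ≤
      3 * ((4 + 2 + Real.log B + Real.pi) * Real.log T) := by
    have a1 : ‖z - c‖ ≤ 3 / 2 := by linarith
    have a2 : R + ‖z - c‖ ≤ 3 := by simp only [hR]; linarith
    have a3 : ‖l c‖ ≤ (2 + Real.log B + Real.pi) * Real.log T := by nlinarith
    have a4 : ‖l c‖ * (R + ‖z - c‖) ≤ (2 + Real.log B + Real.pi) * Real.log T * 3 := by gcongr
    nlinarith
  refine h4.trans ?_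
  have h5 : (4 + 2 + Real.log B + Real.pi) * (6 / η) * Real.log T * (η / 2) =
      3 * ((4 + 2 + Real.log B + Real.pi) * Real.log T) := by field_simp; ring
  rw [← h5]
  gcongr

lemma exists_zetaMulSub_inv_bound (hz : ∀ s : ℂ, 1 / 2 < s.re → riemannZeta s ≠ 0) {η : ℝ}
    (h0 : 0 < η) (h1 : η ≤ 1 / 2) :
    ∃ C : ℝ, 0 < C ∧ ∀ s : ℂ, 1 / 2 + 2 * η ≤ s.re → s.re ≤ 2 →
      ‖zetaMulSub s‖⁻¹ ≤ (11 + 2 * |s.im|) ^ C ∧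
      ∀ w : ℂ, ‖w‖ < η →
        ‖zetaMulSub s‖ ≤ ‖zetaMulSub (s + w)‖ * (11 + 2 * |s.im|) ^ (C * ‖w‖) := by
  obtain ⟨C, hC, h⟩ := exists_log_zetaMulSub_bound hz h0 h1
  refine ⟨max C (2 * C / η), by positivity, fun s hs hs2 => ?_⟩
  obtain ⟨l, hld, hle, hlb⟩ := h s.im
  set T : ℝ := 11 + 2 * |s.im| with hT
  have hT1 : 1 ≤ T := by have := abs_nonneg s.im; simp only [hT]; linarith
  have hT0 : 0 < T := by linarith
  have hdist : ‖s - (2 + s.im * Complex.I)‖ ≤ 3 / 2 - 2 * η := by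
    have : s - (2 + s.im * Complex.I) = ((s.re - 2 : ℝ) : ℂ) := by
      apply Complex.ext <;> simp
    rw [this, Complex.norm_real, Real.norm_eq_abs, abs_le]
    constructor <;> linarith
  have hball : ∀ z ∈ Metric.ball s η, z ∈ Metric.ball (2 + s.im * Complex.I) (3 / 2 - η) := by
    intro z hz
    rw [mem_ball_iff_norm] at hz ⊢
    calc ‖z - (2 + s.im * Complex.I)‖ = ‖(z - s) + (s - (2 + s.im * Complex.I))‖ := by ring_nf
      _ ≤ ‖z - s‖ + ‖s - (2 + s.im * Complex.I)‖ := norm_add_le _ _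
      _ < 3 / 2 - η := by linarith
  have hs' : s ∈ Metric.ball s η := Metric.mem_ball_self h0
  have hpow : ∀ x : ℝ, Real.exp (x * Real.log T) = T ^ x := fun x => by
    rw [Real.rpow_def_of_pos hT0, mul_comm]
  refine ⟨?_, fun w hw => ?_⟩
  · rw [← hle s (hball s hs'), Complex.norm_exp, ← Real.exp_neg]
    calc Real.exp (-(l s).re) ≤ Real.exp (C * Real.log T) := by
          refine Real.exp_le_exp.2 ((neg_le_abs _).trans ((Complex.abs_re_le_norm _).trans ?_))
          exact hlb s (hball s hs')
      _ = T ^ C := hpow C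
      _ ≤ _ := Real.rpow_le_rpow_of_exponent_le hT1 (le_max_left _ _)
  · have hsw : s + w ∈ Metric.ball s η := by simpa [mem_ball_iff_norm] using hw
    have hmaps : Set.MapsTo l (Metric.ball s η)
        (Metric.closedBall (l s) (2 * (C * Real.log T))) := by
      intro z hz
      rw [mem_closedBall_iff_norm]
      refine (norm_sub_le _ _).trans ?_
      linarith [hlb z (hball z hz), hlb s (hball s hs')]
    have hd := Complex.dist_le_div_mul_dist_of_mapsTo_ball (hld.mono hball) hmaps hsw
    rw [dist_eq_norm, dist_eq_norm, add_sub_cancel_left] at hd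
    rw [← hle s (hball s hs'), ← hle (s + w) (hball _ hsw), Complex.norm_exp, Complex.norm_exp]
    have hre : (l s).re - (l (s + w)).re ≤ 2 * C / η * ‖w‖ * Real.log T := by
      have := (Complex.abs_re_le_norm _).trans hd
      have := (abs_le.1 this).1
      simp only [Complex.sub_re] at this
      have e : 2 * (C * Real.log T) / η * ‖w‖ = 2 * C / η * ‖w‖ * Real.log T := by ring
      linarith
    calc Real.exp (l s).re ≤ Real.exp ((l (s + w)).re + 2 * C / η * ‖w‖ * Real.log T) :=
          Real.exp_le_exp.2 (by linarith)
      _ = Real.exp (l (s + w)).re * T ^ (2 * C / η * ‖w‖) := by rw [Real.exp_add, hpow]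
      _ ≤ _ := by
        gcongr
        exact le_max_right _ _

/-- The entire function `s (s - 1) Λ(s)`, where `Λ` is the completed zeta function. -/
noncomputable def xi (s : ℂ) : ℂ := s * (s - 1) * completedRiemannZeta₀ s + 1

lemma differentiable_xi : Differentiable ℂ xi := by
  have := differentiable_completedZeta₀
  unfold xi
  fun_prop

lemma xi_one_sub (s : ℂ) : xi (1 - s) = xi s := by
  simp only [xi, completedRiemannZeta₀_one_sub]
  ring

lemma xi_eq {s : ℂ} (hs : 0 < s.re) : xi s = s * zetaMulSub s * Complex.Gammaℝ s := by
  by_cases h1 : s = 1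
  · simp [h1, xi, Complex.Gammaℝ_one]
  have h0 : s ≠ 0 := by rintro rfl; simp at hs
  have h2 : s - 1 ≠ 0 := sub_ne_zero.2 h1
  have h3 : 1 - s ≠ 0 := sub_ne_zero.2 (Ne.symm h1)
  rw [zetaMulSub_eq hs h1, riemannZeta_def_of_ne_zero h0, completedRiemannZeta_eq, xi]
  have := Complex.Gammaℝ_ne_zero_of_re_pos hs
  field_simp
  ring

lemma xi_conj {s : ℂ} (hs : 0 < s.re) :
    xi ((starRingEnd ℂ) s) = (starRingEnd ℂ) (xi s) := by
  have h : 0 < ((starRingEnd ℂ) s).re := by simpa using hs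
  by_cases h1 : s = 1
  · simp [h1, xi]
  have h1' : (starRingEnd ℂ) s ≠ 1 := fun h => h1 (by simpa using congrArg (starRingEnd ℂ) h)
  have hpi : (Real.pi : ℂ).arg ≠ Real.pi := by
    rw [Complex.arg_ofReal_of_nonneg Real.pi_pos.le]; exact Real.pi_pos.ne
  rw [xi_eq hs, xi_eq h, zetaMulSub_eq hs h1, zetaMulSub_eq h h1', riemannZeta_conj,
    Complex.Gammaℝ_def, Complex.Gammaℝ_def]
  simp only [map_mul, map_sub, map_one]
  have hc : (starRingEnd ℂ) ((Real.pi : ℂ) ^ (-s / 2)) =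
      (Real.pi : ℂ) ^ ((starRingEnd ℂ) (-s / 2)) := by
    rw [Complex.cpow_conj _ _ hpi, Complex.conj_ofReal]
  rw [← Complex.Gamma_conj, hc]
  simp [Complex.conj_ofNat]

lemma xi_ne_zero (hz : ∀ s : ℂ, 1 / 2 < s.re → riemannZeta s ≠ 0) {s : ℂ}
    (hs : 1 / 2 < s.re) : xi s ≠ 0 := by
  have h0 : 0 < s.re := by linarith
  rw [xi_eq h0]
  refine mul_ne_zero (mul_ne_zero ?_ (zetaMulSub_ne_zero hz hs))
    (Complex.Gammaℝ_ne_zero_of_re_pos h0)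
  rintro rfl
  simp at h0

lemma norm_le_norm_add_ofReal {s : ℂ} {δ : ℝ} (hs : 0 ≤ s.re) (hδ : 0 ≤ δ) :
    ‖s‖ ≤ ‖s + δ‖ := by
  rw [Complex.norm_def, Complex.norm_def]
  apply Real.sqrt_le_sqrt
  simp only [Complex.normSq_apply, Complex.add_re, Complex.add_im, Complex.ofReal_re,
    Complex.ofReal_im]
  nlinarith

lemma norm_Gammaℝ (s : ℂ) :
    ‖Complex.Gammaℝ s‖ = Real.pi ^ (-s.re / 2) * ‖Complex.Gamma (s / 2)‖ := by
  rw [Complex.Gammaℝ_def, norm_mul, Complex.norm_cpow_eq_rpow_re_of_pos Real.pi_pos]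
  simp

lemma exists_norm_Gammaℝ_add_le {c : ℝ} (hc : 0 < c) :
    ∃ K : ℝ, 1 ≤ K ∧ ∀ s : ℂ, c ≤ s.re → ∀ δ : ℝ, 0 ≤ δ → δ ≤ 1 →
      ‖Complex.Gammaℝ (s + δ)‖ ≤ K * ‖Complex.Gammaℝ s‖ * ‖s‖ ^ (δ / 2) := by
  obtain ⟨K, hK, h⟩ := exists_norm_Gamma_add_le (half_pos hc)
  refine ⟨K, hK, fun s hs δ h0 h1 => ?_⟩
  have h2 := h (s / 2) (by simp; linarith) (δ / 2) (by linarith) (by linarith)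
  rw [norm_Gammaℝ, norm_Gammaℝ]
  have e : (s + δ) / 2 = s / 2 + ((δ / 2 : ℝ) : ℂ) := by push_cast; ring
  rw [e]
  have h3 : Real.pi ^ (-(s + (δ : ℂ)).re / 2) ≤ Real.pi ^ (-s.re / 2) := by
    apply Real.rpow_le_rpow_of_exponent_le (by linarith [Real.pi_gt_three])
    simp; linarith
  have h4 : ‖s / 2‖ ^ (δ / 2) ≤ ‖s‖ ^ (δ / 2) := by
    apply Real.rpow_le_rpow (norm_nonneg _) _ (by linarith)
    simp [norm_nonneg]
  calc _ ≤ Real.pi ^ (-s.re / 2) * (K * ‖Complex.Gamma (s / 2)‖ * ‖s‖ ^ (δ / 2)) := by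
        gcongr
        exact h2.trans (by gcongr)
    _ = _ := by ring

lemma exists_norm_Gammaℝ_le {c : ℝ} (hc : 0 < c) :
    ∃ M : ℝ, 1 ≤ M ∧ ∀ s : ℂ, c ≤ s.re → ∀ δ : ℝ, 0 ≤ δ → δ ≤ 1 →
      ‖Complex.Gammaℝ s‖ ≤ M * ‖Complex.Gammaℝ (s + δ)‖ := by
  obtain ⟨K, hK, h⟩ := exists_norm_Gamma_add_le (half_pos hc)
  refine ⟨Real.pi * (K * (1 + 4 / c)), ?_, fun s hs δ h0 h1 => ?_⟩
  · have : 0 < 4 / c := by positivity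
    nlinarith [Real.pi_gt_three, mul_pos (by linarith : 0 < K) this]
  have hs0 : s ≠ 0 := by rintro rfl; simp at hs; linarith
  have hsn : c ≤ ‖s‖ := hs.trans (Complex.re_le_norm s)
  have h2 := h (s / 2 + ((δ / 2 : ℝ) : ℂ)) (by simp; linarith) (1 - δ / 2) (by linarith)
    (by linarith)
  have e1 : s / 2 + ((δ / 2 : ℝ) : ℂ) + ((1 - δ / 2 : ℝ) : ℂ) = s / 2 + 1 := by push_cast; ring
  rw [e1, Complex.Gamma_add_one _ (div_ne_zero hs0 two_ne_zero), norm_mul] at h2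
  have e : (s + δ) / 2 = s / 2 + ((δ / 2 : ℝ) : ℂ) := by push_cast; ring
  rw [norm_Gammaℝ, norm_Gammaℝ, e]
  set G := ‖Complex.Gamma (s / 2 + ((δ / 2 : ℝ) : ℂ))‖
  have h3 : Real.pi ^ (-s.re / 2) ≤ Real.pi * Real.pi ^ (-(s + (δ : ℂ)).re / 2) := by
    nth_rw 2 [← Real.rpow_one Real.pi]
    rw [← Real.rpow_add Real.pi_pos]
    apply Real.rpow_le_rpow_of_exponent_le (by linarith [Real.pi_gt_three])
    simp; linarith
  have h4 : ‖s / 2 + ((δ / 2 : ℝ) : ℂ)‖ ^ (1 - δ / 2) ≤ 2 + ‖s / 2‖ := by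
    have h5 : ‖s / 2 + ((δ / 2 : ℝ) : ℂ)‖ ≤ ‖s / 2‖ + 1 := by
      refine (norm_add_le _ _).trans ?_
      rw [Complex.norm_real, Real.norm_of_nonneg (by linarith)]
      linarith
    calc _ ≤ (‖s / 2‖ + 1) ^ (1 - δ / 2) := by gcongr; linarith
      _ ≤ (‖s / 2‖ + 1) ^ (1 : ℝ) := by
        apply Real.rpow_le_rpow_of_exponent_le <;> linarith [norm_nonneg (s / 2)]
      _ ≤ _ := by rw [Real.rpow_one]; linarith
  have h6 : ‖Complex.Gamma (s / 2)‖ ≤ K * G * (1 + 4 / c) := by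
    have h7 : ‖s / 2‖ = ‖s‖ / 2 := by simp
    have hp : 0 < ‖s / 2‖ := by rw [h7]; linarith
    rw [← mul_le_mul_iff_right₀ hp]
    refine h2.trans ?_
    have : 2 + ‖s / 2‖ ≤ ‖s / 2‖ * (1 + 4 / c) := by
      have : 2 ≤ ‖s / 2‖ * (4 / c) := by
        rw [h7, mul_div_assoc', le_div_iff₀ hc]; linarith
      linarith
    calc _ ≤ K * G * (2 + ‖s / 2‖) := by gcongr
      _ ≤ K * G * (‖s / 2‖ * (1 + 4 / c)) := by gcongr
      _ = _ := by ring
  calc _ ≤ Real.pi * Real.pi ^ (-(s + (δ : ℂ)).re / 2) * (K * G * (1 + 4 / c)) := by gcongr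
    _ = _ := by ring

lemma norm_xi_div_le {M : ℝ} {s : ℂ} {ε : ℝ} (hs : 0 < s.re) (hε : 0 ≤ ε)
    (hM : ‖Complex.Gammaℝ s‖ ≤ M * ‖Complex.Gammaℝ (s + ε)‖) :
    ‖xi s / xi (s + ε)‖ ≤ M * (‖zetaMulSub s‖ / ‖zetaMulSub (s + ε)‖) := by
  have hs' : 0 < (s + ε).re := by simp; linarith
  rw [xi_eq hs, xi_eq hs', norm_div, norm_mul, norm_mul, norm_mul, norm_mul, mul_div_mul_comm,
    mul_div_mul_comm]
  have h1 : ‖s‖ / ‖s + ε‖ ≤ 1 :=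
    div_le_one_of_le₀ (norm_le_norm_add_ofReal hs.le hε) (norm_nonneg _)
  have h2 : ‖Complex.Gammaℝ s‖ / ‖Complex.Gammaℝ (s + ε)‖ ≤ M :=
    div_le_of_le_mul₀ (norm_nonneg _) (by
      have := Complex.Gammaℝ_ne_zero_of_re_pos hs
      have h0 : 0 < ‖Complex.Gammaℝ s‖ := norm_pos_iff.2 this
      by_contra! h
      nlinarith [norm_nonneg (Complex.Gammaℝ (s + ε))]) hM
  calc _ ≤ 1 * (‖zetaMulSub s‖ / ‖zetaMulSub (s + ε)‖) * M := by gcongr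
    _ = _ := by ring

lemma exists_norm_xi_div_le_exp (hz : ∀ s : ℂ, 1 / 2 < s.re → riemannZeta s ≠ 0) {ε : ℝ}
    (h0 : 0 < ε) (h1 : ε ≤ 3 / 4) :
    ∃ A B : ℝ, ∀ s : ℂ, 1 / 2 - ε / 2 ≤ s.re → ‖xi s / xi (s + ε)‖ ≤ A * Real.exp (B * ‖s‖) := by
  obtain ⟨M, hM, hMs⟩ := exists_norm_Gammaℝ_le (c := 1 / 8) (by norm_num)
  obtain ⟨C, hC, hCs⟩ := exists_zetaMulSub_inv_bound hz (η := ε / 4) (by linarith) (by linarith)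
  obtain ⟨B, hB, hBs⟩ := exists_norm_zetaMulSub_bounds
  refine ⟨M * (25 * (B * Real.exp (11 * C))), 1 + 2 * C, fun s hs => ?_⟩
  have hs8 : 1 / 8 ≤ s.re := by linarith
  refine (norm_xi_div_le (by linarith) h0.le (hMs s hs8 ε h0.le (by linarith))).trans ?_
  have hnum : ‖zetaMulSub s‖ ≤ 25 * Real.exp ‖s‖ := by
    refine (norm_zetaMulSub_le (by linarith)).trans ?_
    have h3 : ‖s - 1‖ / s.re ≤ 8 * (‖s‖ + 1) := by
      rw [div_le_iff₀ (by linarith)]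
      have : ‖s - 1‖ ≤ ‖s‖ + 1 := (norm_sub_le _ _).trans (by simp)
      nlinarith [norm_nonneg s]
    have := Real.quadratic_le_exp_of_nonneg (norm_nonneg s)
    nlinarith [norm_nonneg s]
  have hE1 : 1 ≤ Real.exp (11 * C) := Real.one_le_exp (by positivity)
  have hE2 : 1 ≤ Real.exp (2 * C * ‖s‖) := Real.one_le_exp (by positivity)
  have hden : ‖zetaMulSub (s + ε)‖⁻¹ ≤ B * Real.exp (11 * C) * Real.exp (2 * C * ‖s‖) := by
    rcases le_total (s + ε).re 2 with h2 | h2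
    · refine ((hCs (s + ε) (by simp; linarith) h2).1).trans ?_
      have him : |(s + ε).im| ≤ ‖s‖ := by simpa using Complex.abs_im_le_norm s
      have hpos : 0 < 11 + 2 * |(s + ε).im| := by positivity
      rw [mul_assoc, ← Real.exp_add, Real.rpow_def_of_pos hpos]
      have h3 : Real.log (11 + 2 * |(s + ε).im|) * C ≤ 11 * C + 2 * C * ‖s‖ := by
        have := Real.log_le_self hpos.le
        nlinarith
      calc _ ≤ 1 * Real.exp (11 * C + 2 * C * ‖s‖) := by rw [one_mul]; gcongr
        _ ≤ _ := by gcongr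
    · have h3 := (hBs _ h2).2
      have h4 : 1 ≤ ‖s + ε - 1‖ := le_trans (by
        simp only [Complex.sub_re, Complex.one_re]; linarith) (Complex.re_le_norm _)
      have h5 : 0 < ‖zetaMulSub (s + ε)‖ := by
        by_contra! h
        nlinarith
      calc _ ≤ B := by
            rw [inv_le_iff_one_le_mul₀ h5]; linarith
        _ ≤ B * Real.exp (11 * C) := le_mul_of_one_le_right (by linarith) hE1
        _ ≤ _ := le_mul_of_one_le_right (by positivity) hE2
  rw [div_eq_mul_inv]
  calc _ ≤ M * ((25 * Real.exp ‖s‖) * (B * Real.exp (11 * C) * Real.exp (2 * C * ‖s‖))) := by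
        gcongr
    _ = M * (25 * (B * Real.exp (11 * C))) * (Real.exp ‖s‖ * Real.exp (2 * C * ‖s‖)) := by ring
    _ = _ := by rw [← Real.exp_add]; ring_nf

/-- Moving to the right from the critical line increases the modulus of `xi`
when `xi` has no zeros to the right of that line. -/
lemma norm_xi_le_norm_xi_add (hz : ∀ s : ℂ, 1 / 2 < s.re → riemannZeta s ≠ 0) {ε : ℝ}
    (h0 : 0 < ε) (h1 : ε ≤ 3 / 4) {s : ℂ} (hs : s.re = 1 / 2) : ‖xi s‖ ≤ ‖xi (s + ε)‖ := by
  set a : ℂ := ((1 / 2 - ε / 2 : ℝ) : ℂ) with ha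
  have hare : a.re = 1 / 2 - ε / 2 := Complex.ofReal_re _
  have haim : a.im = 0 := Complex.ofReal_im _
  have hne : ∀ z : ℂ, 0 ≤ z.re → xi (z + a + ε) ≠ 0 := fun z h =>
    xi_ne_zero hz (by simp [hare]; linarith)
  have hf : ‖xi (s - a + a) / xi (s - a + a + ε)‖ ≤ 1 := by
    refine PhragmenLindelof.right_half_plane_of_bounded_on_real
      (f := fun z => xi (z + a) / xi (z + a + ε)) (z := s - a) ?_ ?_ ?_ ?_ ?_
    · refine DifferentiableOn.diffContOnCl fun z hz' => ?_
      rw [Complex.closure_setOfPred_lt_re] at hz'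
      have hd1 : Differentiable ℂ fun z => xi (z + a) := differentiable_xi.comp (by fun_prop)
      have hd2 : Differentiable ℂ fun z => xi (z + a + ε) := differentiable_xi.comp (by fun_prop)
      exact ((hd1 z).div (hd2 z) (hne z hz')).differentiableWithinAt
    · obtain ⟨A, B, h⟩ := exists_norm_xi_div_le_exp hz h0 h1
      refine ⟨1, by norm_num, |B|, ?_⟩
      refine Asymptotics.IsBigO.of_bound (|A| * Real.exp |B|) ?_
      refine Filter.eventually_inf_principal.2 (Filter.Eventually.of_forall fun z hz' => ?_)
      have hz'' : 0 < z.re := hz'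
      refine (h (z + a) (by simp [hare]; linarith)).trans ?_
      rw [Real.norm_of_nonneg (Real.exp_pos _).le, Real.rpow_one, mul_assoc, ← Real.exp_add]
      have h3 : ‖z + a‖ ≤ ‖z‖ + 1 := by
        refine (norm_add_le _ _).trans ?_
        gcongr
        rw [ha, Complex.norm_real, Real.norm_of_nonneg (by linarith)]
        linarith
      have h4 : B * ‖z + a‖ ≤ |B| + |B| * ‖z‖ := by
        calc _ ≤ |B| * ‖z + a‖ := by gcongr; exact le_abs_self B
          _ ≤ |B| * (‖z‖ + 1) := by gcongr
          _ = _ := by ring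
      gcongr
      exact le_abs_self A
    · obtain ⟨M, hM, hMs⟩ := exists_norm_Gammaℝ_le (c := 1 / 8) (by norm_num)
      obtain ⟨B, hB, hBs⟩ := exists_norm_zetaMulSub_bounds
      refine Filter.isBoundedUnder_of_eventually_le (a := M * (B * B)) ?_
      filter_upwards [Filter.eventually_ge_atTop 2] with x hx
      have hre : (x + a : ℂ).re = x + (1 / 2 - ε / 2) := by simp [hare]
      refine (norm_xi_div_le (by rw [hre]; linarith) h0.le
        (hMs _ (by rw [hre]; linarith) ε h0.le (by linarith))).trans ?_
      have e1 := (hBs (x + a) (by rw [hre]; linarith)).1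
      have e2 := (hBs (x + a + ε) (by rw [Complex.add_re, hre, Complex.ofReal_re]; linarith)).2
      have e3 : ‖(x : ℂ) + a - 1‖ ≤ ‖x + a + ε - 1‖ := by
        have := norm_le_norm_add_ofReal (s := x + a - 1) (δ := ε)
          (by rw [Complex.sub_re, hre, Complex.one_re]; linarith) h0.le
        convert this using 2
        ring
      gcongr
      apply div_le_of_le_mul₀ (norm_nonneg _) (by positivity)
      calc _ ≤ B * (B * ‖zetaMulSub (x + a + ε)‖) := by
            refine e1.trans ?_
            gcongr
            exact e3.trans e2
        _ = _ := by ring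
    · intro y
      have h3 : 0 < (y * Complex.I + a + ε).re := by
        simp only [Complex.add_re, hare, Complex.ofReal_re, Complex.mul_re, Complex.I_re,
          Complex.I_im, Complex.ofReal_im]
        linarith
      have h2 : y * Complex.I + a = 1 - (starRingEnd ℂ) (y * Complex.I + a + ε) := by
        apply Complex.ext
        · simp [hare]; ring
        · simp [haim]
      have h4 : ‖xi (y * Complex.I + a)‖ = ‖xi (y * Complex.I + a + ε)‖ := by
        conv_lhs => rw [h2, xi_one_sub, xi_conj h3, RCLike.norm_conj]
      rw [norm_div, h4]
      exact div_self_le_one _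
    · rw [Complex.sub_re, hare, hs]; linarith
  rw [sub_add_cancel, norm_div] at hf
  have : 0 < ‖xi (s + ε)‖ := norm_pos_iff.2 (xi_ne_zero hz (by simp [hs]; linarith))
  exact (div_le_one this).1 hf

/-- Comparison of the zeta function on the critical line with its values to the right. -/
lemma exists_norm_zetaMulSub_le_add (hz : ∀ s : ℂ, 1 / 2 < s.re → riemannZeta s ≠ 0) :
    ∃ K : ℝ, 1 ≤ K ∧ ∀ s : ℂ, s.re = 1 / 2 → ∀ ε : ℝ, 0 < ε → ε ≤ 3 / 4 →
      ‖zetaMulSub s‖ ≤ K * ‖zetaMulSub (s + ε)‖ * ‖s‖ ^ (ε / 2) := by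
  obtain ⟨K, hK, h⟩ := exists_norm_Gammaℝ_add_le (c := 1 / 2) (by norm_num)
  refine ⟨5 / 2 * K, by linarith, fun s hs ε h0 h1 => ?_⟩
  have hx := norm_xi_le_norm_xi_add hz h0 h1 hs
  have hre : (s + ε).re = 1 / 2 + ε := by simp [hs]
  have hG := h s hs.ge ε h0.le (by linarith)
  rw [xi_eq (by linarith), xi_eq (by linarith), norm_mul, norm_mul, norm_mul, norm_mul] at hx
  have hGpos : 0 < ‖Complex.Gammaℝ s‖ :=
    norm_pos_iff.2 (Complex.Gammaℝ_ne_zero_of_re_pos (by linarith))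
  have hsn : 1 / 2 ≤ ‖s‖ := hs.ge.trans (Complex.re_le_norm s)
  have hsε : ‖s + ε‖ ≤ 5 / 2 * ‖s‖ := by
    refine (norm_add_le _ _).trans ?_
    rw [Complex.norm_real, Real.norm_of_nonneg h0.le]
    linarith
  rw [← mul_le_mul_iff_right₀ (mul_pos (by linarith : 0 < ‖s‖) hGpos)]
  calc _ = ‖s‖ * ‖zetaMulSub s‖ * ‖Complex.Gammaℝ s‖ := by ring
    _ ≤ _ := hx
    _ ≤ 5 / 2 * ‖s‖ * ‖zetaMulSub (s + ε)‖ * (K * ‖Complex.Gammaℝ s‖ * ‖s‖ ^ (ε / 2)) := by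
        gcongr
    _ = _ := by ring

lemma differentiableOn_integral_of_norm_le {α : Type*} [MeasurableSpace α] {μ : Measure α}
    {U : Set ℂ} (hU : IsOpen U) {F : ℂ → α → ℂ} {b : α → ℝ} (hb : Integrable b μ)
    (hm : ∀ w ∈ U, AEStronglyMeasurable (F w) μ)
    (hd : ∀ t, DifferentiableOn ℂ (fun w => F w t) U) (hF : ∀ w ∈ U, ∀ t, ‖F w t‖ ≤ b t) :
    DifferentiableOn ℂ (fun w => ∫ t, F w t ∂μ) U := by
  intro w₀ hw₀
  obtain ⟨R, hR, hball⟩ := Metric.isOpen_iff.1 hU w₀ hw₀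
  have hR2 : 0 < R / 2 := by linarith
  have hsub : Metric.ball w₀ (R / 2) ⊆ Metric.ball w₀ R := Metric.ball_subset_ball (by linarith)
  have hmem : w₀ ∈ Metric.ball w₀ (R / 2) := Metric.mem_ball_self hR2
  have hder : ∀ t, ∀ w ∈ U, HasDerivAt (fun w => F w t) (deriv (fun w => F w t) w) w :=
    fun t w hw => ((hd t).differentiableAt (hU.mem_nhds hw)).hasDerivAt
  have hmeas : AEStronglyMeasurable (fun t => deriv (fun w => F w t) w₀) μ := by
    have hu : Filter.Tendsto (fun n : ℕ => w₀ + ((R / 2 / (n + 1) : ℝ) : ℂ)) Filter.atTop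
        (nhdsWithin w₀ {w₀}ᶜ) := by
      refine tendsto_nhdsWithin_iff.2 ⟨?_, Filter.Eventually.of_forall fun n => ?_⟩
      · have h1 : Filter.Tendsto (fun n : ℕ => R / 2 / ((n : ℝ) + 1)) Filter.atTop (nhds 0) := by
          simpa [div_eq_mul_inv] using
            (tendsto_one_div_add_atTop_nhds_zero_nat (𝕜 := ℝ)).const_mul (R / 2)
        have h2 := (Complex.continuous_ofReal.tendsto 0).comp h1
        simpa using h2.const_add w₀
      · have : (0 : ℝ) < R / 2 / (n + 1) := by positivity
        rw [Set.mem_compl_iff, Set.mem_singleton_iff, add_eq_left]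
        exact Complex.ofReal_ne_zero.2 this.ne'
    refine aestronglyMeasurable_of_tendsto_ae Filter.atTop
      (f := fun (n : ℕ) t => slope (fun w => F w t) w₀ (w₀ + ((R / 2 / (n + 1) : ℝ) : ℂ)))
      (fun n => ?_) (Filter.Eventually.of_forall fun t => ?_)
    · have hn : w₀ + ((R / 2 / (n + 1) : ℝ) : ℂ) ∈ U := hball (by
        rw [Metric.mem_ball, dist_eq_norm, add_sub_cancel_left, Complex.norm_real,
          Real.norm_of_nonneg (by positivity), div_lt_iff₀ (by positivity)]
        nlinarith [(n.cast_nonneg : (0 : ℝ) ≤ n)])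
      simp only [slope_def_module]
      exact ((hm _ hn).sub (hm _ hw₀)).const_smul ((w₀ + ((R / 2 / (n + 1) : ℝ) : ℂ) - w₀)⁻¹)
    · exact (hasDerivAt_iff_tendsto_slope.1 (hder t w₀ hw₀)).comp hu
  refine (hasDerivAt_integral_of_dominated_loc_of_deriv_le (s := Metric.ball w₀ (R / 2))
    (F' := fun w t => deriv (fun w => F w t) w) (bound := fun t => b t / (R / 4))
    (Metric.ball_mem_nhds _ hR2) ?_ ?_ hmeas ?_ (hb.div_const _)
    ?_).2.differentiableAt.differentiableWithinAt
  · filter_upwards [hU.mem_nhds hw₀] with w hw using hm w hw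
  · exact hb.mono' (hm _ hw₀) (Filter.Eventually.of_forall (hF _ hw₀))
  · refine Filter.Eventually.of_forall fun t w hw => ?_
    have hsub2 : Metric.closedBall w (R / 4) ⊆ U := fun z hz => hball (by
      rw [Metric.mem_ball] at hw ⊢
      rw [Metric.mem_closedBall] at hz
      linarith [dist_triangle z w w₀])
    refine Complex.norm_deriv_le_of_forall_mem_sphere_norm_le (by linarith) ?_
      fun z hz => hF z (hsub2 (Metric.sphere_subset_closedBall hz)) t
    exact DifferentiableOn.diffContOnCl ((hd t).mono
      (Metric.closure_ball_subset_closedBall.trans hsub2))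
  · exact Filter.Eventually.of_forall fun t w hw => hder t w (hball (hsub hw))

/-- The point of the critical line at height `2πt`. -/
noncomputable def critPoint (t : ℝ) : ℂ := 1 / 2 + ((2 * Real.pi * t : ℝ) : ℂ) * Complex.I

@[simp] lemma critPoint_re (t : ℝ) : (critPoint t).re = 1 / 2 := by
  simp [critPoint]

@[simp] lemma critPoint_im (t : ℝ) : (critPoint t).im = 2 * Real.pi * t := by
  simp [critPoint]

lemma continuous_critPoint : Continuous critPoint := by
  unfold critPoint
  fun_prop

lemma critPoint_injective : Function.Injective critPoint := fun t u h => by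
  have := congrArg Complex.im h
  simpa [Real.pi_ne_zero] using this

lemma half_le_norm_critPoint (t : ℝ) : 1 / 2 ≤ ‖critPoint t‖ :=
  (critPoint_re t).ge.trans (Complex.re_le_norm _)

lemma critPoint_ne_zero (t : ℝ) : critPoint t ≠ 0 :=
  norm_pos_iff.1 (by linarith [half_le_norm_critPoint t])

lemma norm_critPoint_sub_one (t : ℝ) : ‖critPoint t - 1‖ = ‖critPoint t‖ := by
  rw [Complex.norm_def, Complex.norm_def, Complex.normSq_apply, Complex.normSq_apply]
  congr 1
  simp
  norm_num

lemma critPoint_sub_one_ne_zero (t : ℝ) : critPoint t - 1 ≠ 0 :=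
  norm_pos_iff.1 (by linarith [half_le_norm_critPoint t, norm_critPoint_sub_one t])

lemma critPoint_ne_one (t : ℝ) : critPoint t ≠ 1 := sub_ne_zero.1 (critPoint_sub_one_ne_zero t)

lemma memLp_norm_critPoint_rpow : MemLp (fun t => ‖critPoint t‖ ^ (-(9 / 16) : ℝ)) 2 volume := by
  have hc : Continuous fun t => ‖critPoint t‖ ^ (-(9 / 16) : ℝ) :=
    continuous_critPoint.norm.rpow_const fun t => Or.inl (norm_ne_zero_iff.2 (critPoint_ne_zero t))
  rw [memLp_two_iff_integrable_sq hc.aestronglyMeasurable]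
  have hi : Integrable (fun x : ℝ => ((1 : ℝ) + ‖x‖ ^ 2) ^ (-(9 / 8 : ℝ) / 2)) volume :=
    integrable_rpow_neg_one_add_norm_sq (by norm_num)
  refine (hi.const_mul ((1 / 4 : ℝ) ^ (-(9 / 8 : ℝ) / 2))).mono'
    (hc.pow 2).aestronglyMeasurable (Filter.Eventually.of_forall fun t => ?_)
  have hsq : ‖critPoint t‖ ^ 2 = 1 / 4 + (2 * Real.pi * t) ^ 2 := by
    rw [Complex.sq_norm, Complex.normSq_apply, critPoint_re, critPoint_im]
    ring
  rw [Real.norm_of_nonneg (by positivity), ← Real.mul_rpow (by norm_num) (by positivity),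
    ← Real.rpow_natCast, ← Real.rpow_mul (norm_nonneg _)]
  have e : ‖critPoint t‖ ^ (-(9 / 16 : ℝ) * (2 : ℕ)) =
      (‖critPoint t‖ ^ 2) ^ (-(9 / 8 : ℝ) / 2) := by
    rw [← Real.rpow_natCast (‖critPoint t‖) 2, ← Real.rpow_mul (norm_nonneg _)]
    norm_num
  rw [e, hsq]
  apply Real.rpow_le_rpow_of_nonpos (by positivity) _ (by norm_num)
  rw [Real.norm_eq_abs, sq_abs]
  have h1 : 1 ≤ Real.pi * Real.pi := by nlinarith [Real.pi_gt_three]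
  nlinarith [mul_le_mul_of_nonneg_right h1 (sq_nonneg t), sq_nonneg t]

lemma ae_zetaMulSub_critPoint_ne_zero : ∀ᵐ t, zetaMulSub (critPoint t) ≠ 0 := by
  have hcount : {t | zetaMulSub (critPoint t) = 0}.Countable := by
    have hsub : {t | zetaMulSub (critPoint t) = 0} ⊆
        ⋃ N : ℕ, critPoint ⁻¹' (critPoint '' Set.Icc (-N : ℝ) N ∩ riemannZetaZeros) := by
      intro t ht
      obtain ⟨N, hN⟩ := exists_nat_ge |t|
      refine Set.mem_iUnion.2 ⟨N, ⟨t, abs_le.1 hN, rfl⟩, ?_⟩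
      rw [Set.mem_ofPred_eq, zetaMulSub_eq (by simp) (critPoint_ne_one t)] at ht
      exact (mul_eq_zero.1 ht).resolve_left (critPoint_sub_one_ne_zero t)
    refine (Set.countable_iUnion fun N => ?_).mono hsub
    exact ((isCompact_Icc.image continuous_critPoint).inter_riemannZetaZeros_finite.preimage
      critPoint_injective.injOn).countable
  exact (hcount.ae_notMem volume)

/-- The function `ζ(s) / (s ζ(s + w))` on the critical line, written without poles. -/
noncomputable def zetaQuot (w : ℂ) (t : ℝ) : ℂ :=
  zetaMulSub (critPoint t) / zetaMulSub (critPoint t + w) *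
    ((critPoint t + w - 1) / (critPoint t * (critPoint t - 1)))

lemma continuous_zetaMulSub_critPoint_add {w : ℂ} (hw : 0 ≤ w.re) :
    Continuous fun t => zetaMulSub (critPoint t + w) := by
  refine continuous_iff_continuousAt.2 fun t => ?_
  have h : 0 < (critPoint t + w).re := by simp; linarith
  have h1 : ContinuousAt zetaMulSub (critPoint t + w) :=
    (differentiableOn_zetaMulSub.differentiableAt
      ((Complex.continuous_re.isOpen_preimage _ isOpen_Ioi).mem_nhds h)).continuousAt
  exact h1.comp (f := fun t => critPoint t + w) (continuous_critPoint.add_const w).continuousAt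

lemma continuous_zetaQuot (hz : ∀ s : ℂ, 1 / 2 < s.re → riemannZeta s ≠ 0) {w : ℂ}
    (hw : 0 < w.re) : Continuous (zetaQuot w) := by
  have h0 := continuous_zetaMulSub_critPoint_add (w := 0) le_rfl
  simp only [add_zero] at h0
  refine (h0.div (continuous_zetaMulSub_critPoint_add hw.le) fun t =>
    zetaMulSub_ne_zero hz (by simp; linarith)).mul (Continuous.div ?_ ?_ fun t =>
      mul_ne_zero (critPoint_ne_zero t) (critPoint_sub_one_ne_zero t))
  · exact (continuous_critPoint.add_const w).sub continuous_const
  · exact continuous_critPoint.mul (continuous_critPoint.sub continuous_const)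

lemma zetaQuot_eq {w : ℂ} {t : ℝ} (hw : 0 < w.re) (h1 : critPoint t + w ≠ 1) :
    zetaQuot w t = riemannZeta (critPoint t) / critPoint t * (riemannZeta (critPoint t + w))⁻¹ := by
  have h := sub_ne_zero.2 h1
  have h2 := critPoint_sub_one_ne_zero t
  rw [zetaQuot, zetaMulSub_eq (by simp) (critPoint_ne_one t), zetaMulSub_eq (by simp; linarith) h1]
  field_simp

lemma differentiableOn_zetaQuot (hz : ∀ s : ℂ, 1 / 2 < s.re → riemannZeta s ≠ 0) (t : ℝ) :
    DifferentiableOn ℂ (fun w => zetaQuot w t) {w | 0 < w.re} := by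
  intro w hw
  have hw' : 0 < w.re := hw
  have h : 0 < (critPoint t + w).re := by simp; linarith
  have h1 : DifferentiableAt ℂ zetaMulSub (critPoint t + w) :=
    differentiableOn_zetaMulSub.differentiableAt
      ((Complex.continuous_re.isOpen_preimage _ isOpen_Ioi).mem_nhds h)
  have h2 : DifferentiableAt ℂ (fun w => zetaMulSub (critPoint t + w)) w :=
    h1.comp (f := fun w => critPoint t + w) w (by fun_prop)
  refine (((differentiableAt_const _).div h2 (zetaMulSub_ne_zero hz (by simp; linarith))).mul
    (DifferentiableAt.div_const ?_ _)).differentiableWithinAt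
  fun_prop

lemma rpow_le_two_mul_rpow {x p q : ℝ} (hx : 1 / 2 ≤ x) (hpq : p ≤ q) (hq : q ≤ p + 1) :
    x ^ p ≤ 2 * x ^ q := by
  have hx0 : 0 < x := by linarith
  have h1 : (x⁻¹) ^ (q - p) ≤ 2 := by
    have h2 : x⁻¹ ≤ 2 := (inv_le_comm₀ hx0 (by norm_num)).2 (by linarith)
    calc _ ≤ (2 : ℝ) ^ (q - p) := by gcongr
      _ ≤ (2 : ℝ) ^ (1 : ℝ) := by
        apply Real.rpow_le_rpow_of_exponent_le <;> linarith
      _ = 2 := Real.rpow_one 2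
  calc x ^ p = (x⁻¹) ^ (q - p) * x ^ q := by
        rw [Real.inv_rpow hx0.le, ← Real.rpow_neg hx0.le, ← Real.rpow_add hx0]
        ring_nf
    _ ≤ _ := by gcongr

lemma norm_zetaQuot_le (hz : ∀ s : ℂ, 1 / 2 < s.re → riemannZeta s ≠ 0) {K a p : ℝ} {w : ℂ} {t : ℝ}
    (hK : 1 ≤ K) (ha0 : 0 < a) (ha : a ≤ 3 / 4) (hw0 : 0 < w.re) (hw : ‖w‖ ≤ 2) (hp : p ≤ 1 / 16)
    (h1 : ‖zetaMulSub (critPoint t)‖ ≤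
      K * ‖zetaMulSub (critPoint t + a)‖ * ‖critPoint t‖ ^ (a / 2))
    (h2 : ‖zetaMulSub (critPoint t + a)‖ ≤
      ‖zetaMulSub (critPoint t + w)‖ * (11 + 2 * |(critPoint t).im|) ^ p) :
    ‖zetaQuot w t‖ ≤ 240 * K * ‖critPoint t‖ ^ (-(9 / 16) : ℝ) := by
  have hx := half_le_norm_critPoint t
  have e1 := norm_critPoint_sub_one t
  have him := Complex.abs_im_le_norm (critPoint t)
  have hne : 0 < ‖zetaMulSub (critPoint t + w)‖ :=
    norm_pos_iff.2 (zetaMulSub_ne_zero hz (by simp; linarith))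
  have h5 : ‖critPoint t + w - 1‖ ≤ 5 * ‖critPoint t‖ := by
    calc _ = ‖(critPoint t - 1) + w‖ := by ring_nf
      _ ≤ ‖critPoint t - 1‖ + ‖w‖ := norm_add_le _ _
      _ ≤ _ := by linarith
  set x := ‖critPoint t‖
  set y := |(critPoint t).im|
  have hy : 0 ≤ y := abs_nonneg _
  have hx0 : 0 < x := by linarith
  have h3 : x ^ (a / 2) ≤ 2 * x ^ (3 / 8 : ℝ) :=
    rpow_le_two_mul_rpow hx (by linarith) (by linarith)
  have h4 : (11 + 2 * y) ^ p ≤ 24 * x ^ (1 / 16 : ℝ) := by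
    calc _ ≤ (11 + 2 * y) ^ (1 / 16 : ℝ) := by
          apply Real.rpow_le_rpow_of_exponent_le <;> linarith
      _ ≤ (24 * x) ^ (1 / 16 : ℝ) := by gcongr; linarith
      _ = (24 : ℝ) ^ (1 / 16 : ℝ) * x ^ (1 / 16 : ℝ) := Real.mul_rpow (by norm_num) hx0.le
      _ ≤ (24 : ℝ) ^ (1 : ℝ) * x ^ (1 / 16 : ℝ) := by
          gcongr
          · norm_num
          · norm_num
      _ = _ := by rw [Real.rpow_one]
  have h6 : ‖zetaMulSub (critPoint t)‖ / ‖zetaMulSub (critPoint t + w)‖ ≤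
      K * (24 * x ^ (1 / 16 : ℝ)) * (2 * x ^ (3 / 8 : ℝ)) := by
    rw [div_le_iff₀ hne]
    calc _ ≤ K * (‖zetaMulSub (critPoint t + w)‖ * (24 * x ^ (1 / 16 : ℝ))) *
          (2 * x ^ (3 / 8 : ℝ)) := by
          refine h1.trans ?_
          gcongr
          exact h2.trans (by gcongr)
      _ = _ := by ring
  rw [zetaQuot, norm_mul, norm_div, norm_div, norm_mul, e1]
  calc _ ≤ K * (24 * x ^ (1 / 16 : ℝ)) * (2 * x ^ (3 / 8 : ℝ)) * (5 * x / (x * x)) := by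
        gcongr
    _ = 240 * K * (x ^ (1 / 16 : ℝ) * x ^ (3 / 8 : ℝ) * x ^ (-1 : ℝ)) := by
        rw [Real.rpow_neg_one]
        field_simp
        norm_num
    _ = _ := by
        rw [← Real.rpow_add hx0, ← Real.rpow_add hx0]
        norm_num

lemma exists_norm_zetaQuot_ofReal_le (hz : ∀ s : ℂ, 1 / 2 < s.re → riemannZeta s ≠ 0) :
    ∃ K : ℝ, 0 ≤ K ∧ ∀ a : ℝ, 0 < a → a ≤ 3 / 4 → ∀ t : ℝ,
      ‖zetaQuot a t‖ ≤ K * ‖critPoint t‖ ^ (-(9 / 16) : ℝ) := by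
  obtain ⟨K, hK, h⟩ := exists_norm_zetaMulSub_le_add hz
  refine ⟨240 * K, by linarith, fun a h0 h1 t => ?_⟩
  refine norm_zetaQuot_le hz (p := 0) hK h0 h1 (by simpa using h0) ?_ (by norm_num)
    (h _ (critPoint_re t) a h0 h1) (by simp)
  rw [Complex.norm_real, Real.norm_of_nonneg h0.le]
  linarith

lemma exists_norm_zetaQuot_le (hz : ∀ s : ℂ, 1 / 2 < s.re → riemannZeta s ≠ 0) {ε : ℝ}
    (h0 : 0 < ε) (h1 : ε ≤ 1) :
    ∃ K r : ℝ, 0 < r ∧ ∀ w : ℂ, ε < w.re → w.re < 3 / 4 → |w.im| < r → ∀ t : ℝ,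
      ‖zetaQuot w t‖ ≤ K * ‖critPoint t‖ ^ (-(9 / 16) : ℝ) := by
  obtain ⟨K, hK, h⟩ := exists_norm_zetaMulSub_le_add hz
  obtain ⟨C, hC, hCs⟩ := exists_zetaMulSub_inv_bound hz (η := ε / 2) (by linarith) (by linarith)
  refine ⟨240 * K, min (ε / 2) (1 / (16 * C)), by positivity, fun w hw0 hw1 hwr t => ?_⟩
  obtain ⟨hr1, hr2⟩ := lt_min_iff.1 hwr
  have hI : ‖(w.im : ℂ) * Complex.I‖ = |w.im| := by simp
  have h2 := (hCs (critPoint t + w.re) (by simp; linarith) (by simp; linarith)).2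
    (w.im * Complex.I) (by rwa [hI])
  rw [add_assoc, Complex.re_add_im, hI] at h2
  refine norm_zetaQuot_le hz (a := w.re) (p := C * |w.im|) hK (by linarith) hw1.le (by linarith) ?_
    ?_ (h _ (critPoint_re t) _ (by linarith) hw1.le) (by simpa using h2)
  · refine (Complex.norm_le_abs_re_add_abs_im w).trans ?_
    rw [abs_of_pos (by linarith : 0 < w.re)]
    linarith
  · rw [lt_div_iff₀ (by positivity)] at hr2
    linarith

lemma integrable_mul_norm_critPoint_rpow {h : ℝ → ℂ} (hh : MemLp h 2 volume) (K : ℝ) :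
    Integrable (fun t => ‖h t‖ * (K * ‖critPoint t‖ ^ (-(9 / 16) : ℝ))) :=
  hh.norm.integrable_mul (memLp_norm_critPoint_rpow.const_mul K)

lemma continuous_riemannZeta_div_critPoint :
    Continuous fun t => riemannZeta (critPoint t) / critPoint t := by
  refine Continuous.div (continuous_iff_continuousAt.2 fun t => ?_) continuous_critPoint
    critPoint_ne_zero
  exact (differentiableAt_riemannZeta (critPoint_ne_one t)).continuousAt.comp
    (f := critPoint) continuous_critPoint.continuousAt

lemma integrable_mul_riemannZeta_div (hz : ∀ s : ℂ, 1 / 2 < s.re → riemannZeta s ≠ 0)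
    {h : ℝ → ℂ} (hh : MemLp h 2 volume) :
    Integrable fun t => h t * (riemannZeta (critPoint t) / critPoint t) := by
  obtain ⟨K, hK, hKt⟩ := exists_norm_zetaQuot_ofReal_le hz
  set B := ∑' n : ℕ, ‖LSeries.term 1 (9 / 8 : ℝ) n‖
  have hB : 0 ≤ B := tsum_nonneg fun n => norm_nonneg _
  refine (integrable_mul_norm_critPoint_rpow hh (K * B)).mono'
    (hh.1.mul continuous_riemannZeta_div_critPoint.aestronglyMeasurable)
    (Filter.Eventually.of_forall fun t => ?_)
  set w : ℂ := ((5 / 8 : ℝ) : ℂ) with hw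
  have hre : (critPoint t + w).re = 9 / 8 := by
    rw [Complex.add_re, critPoint_re, hw, Complex.ofReal_re]; norm_num
  have hne : riemannZeta (critPoint t + w) ≠ 0 := hz _ (by rw [hre]; norm_num)
  have hzb : ‖riemannZeta (critPoint t + w)‖ ≤ B := by
    rw [← LSeries_one_eq_riemannZeta (by rw [hre]; norm_num)]
    exact norm_LSeries_le_of_le_re (by simp) (by norm_num) hre.ge
  have h1 : critPoint t + w ≠ 1 := by
    intro h
    rw [h] at hre
    norm_num at hre
  have h2 : riemannZeta (critPoint t) / critPoint t =
      zetaQuot w t * riemannZeta (critPoint t + w) := by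
    rw [zetaQuot_eq (by rw [hw, Complex.ofReal_re]; norm_num) h1, inv_mul_cancel_right₀ hne]
  rw [norm_mul, h2, norm_mul]
  calc _ ≤ ‖h t‖ * (K * ‖critPoint t‖ ^ (-(9 / 16) : ℝ) * B) := by
        gcongr
        exact hKt _ (by norm_num) (by norm_num) t
    _ = _ := by ring

lemma integral_mul_zetaQuot_eq_zero_of_half_lt
    (hz : ∀ s : ℂ, 1 / 2 < s.re → riemannZeta s ≠ 0) {h : ℝ → ℂ} (hh : MemLp h 2 volume)
    (h0 : ∀ n : ℕ, 1 ≤ n →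
      ∫ t, h t * (riemannZeta (critPoint t) / critPoint t * (n : ℂ) ^ (-critPoint t)) = 0)
    {a : ℝ} (ha : 1 / 2 < a) : ∫ t, h t * zetaQuot a t = 0 := by
  have hre : ∀ t, (critPoint t + a).re = 1 / 2 + a := fun t => by simp
  set m : ℕ → ℂ := fun n => ((ArithmeticFunction.moebius n : ℤ) : ℂ)
  have hm : ∀ n, ‖m n‖ ≤ 1 := fun n => by
    rw [Complex.norm_intCast]
    exact_mod_cast ArithmeticFunction.abs_moebius_le_one
  set f : ℝ → ℂ := fun t => h t * (riemannZeta (critPoint t) / critPoint t)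
  have hf : Integrable f := integrable_mul_riemannZeta_div hz hh
  have hbd : ∀ n t, ‖LSeries.term m (critPoint t + a) n‖ ≤
      ‖LSeries.term 1 ((1 / 2 + a : ℝ) : ℂ) n‖ := fun n t =>
    (LSeries.norm_term_le _ (g := 1) (by simpa using hm n)).trans
      (LSeries.norm_term_le_of_re_le_re 1 (by rw [hre, Complex.ofReal_re]) n)
  have hcont : ∀ n, Continuous fun t => LSeries.term m (critPoint t + a) n := fun n => by
    rcases eq_or_ne n 0 with rfl | hn
    · simpa using continuous_const
    · simp only [LSeries.term_of_ne_zero hn]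
      have hn' : (n : ℂ) ≠ 0 := Nat.cast_ne_zero.2 hn
      exact continuous_const.div ((continuous_critPoint.add_const _).const_cpow (Or.inl hn'))
        fun t => by simp [Complex.cpow_eq_zero_iff, hn']
  have hFn : ∀ n t, ‖f t * LSeries.term m (critPoint t + a) n‖ ≤
      ‖f t‖ * ‖LSeries.term 1 ((1 / 2 + a : ℝ) : ℂ) n‖ := fun n t => by
    rw [norm_mul]
    gcongr
    exact hbd n t
  have hint : ∀ n, Integrable fun t => f t * LSeries.term m (critPoint t + a) n := fun n =>
    (hf.norm.mul_const _).mono' (hf.1.mul (hcont n).aestronglyMeasurable)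
      (Filter.Eventually.of_forall (hFn n))
  have hsum : Summable fun n => ∫ t, ‖f t * LSeries.term m (critPoint t + a) n‖ := by
    have h2 : Summable fun n => ‖LSeries.term 1 ((1 / 2 + a : ℝ) : ℂ) n‖ :=
      (LSeriesSummable_one_iff.2 (by rw [Complex.ofReal_re]; linarith)).norm
    refine Summable.of_nonneg_of_le (fun n => integral_nonneg fun t => norm_nonneg _) (fun n => ?_)
      (h2.mul_left (∫ t, ‖f t‖))
    rw [← integral_mul_const]
    exact integral_mono (hint n).norm (hf.norm.mul_const _) (hFn n)
  have hzero : ∀ n, ∫ t, f t * LSeries.term m (critPoint t + a) n = 0 := fun n => by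
    rcases eq_or_ne n 0 with rfl | hn
    · simp
    have hn' : (n : ℂ) ≠ 0 := Nat.cast_ne_zero.2 hn
    have e : ∀ t, f t * LSeries.term m (critPoint t + a) n = m n * (n : ℂ) ^ (-(a : ℂ)) *
        (h t * (riemannZeta (critPoint t) / critPoint t * (n : ℂ) ^ (-critPoint t))) := fun t => by
      rw [LSeries.term_of_ne_zero hn, div_eq_mul_inv, ← Complex.cpow_neg, neg_add,
        Complex.cpow_add _ _ hn']
      ring
    simp_rw [e]
    rw [integral_const_mul, h0 n (Nat.one_le_iff_ne_zero.2 hn), mul_zero]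
  have key := hasSum_integral_of_summable_integral_norm hint hsum
  simp_rw [hzero] at key
  rw [← key.unique hasSum_zero]
  congr 1 with t
  have h1 : 1 < (critPoint t + a).re := by rw [hre]; linarith
  have hne1 : critPoint t + a ≠ 1 := fun h => by rw [h] at h1; simp at h1
  have hL := ArithmeticFunction.LSeries_zeta_mul_Lseries_moebius h1
  rw [ArithmeticFunction.LSeries_zeta_eq_riemannZeta h1] at hL
  rw [tsum_mul_left, zetaQuot_eq (by simp; linarith) hne1, ← mul_assoc]
  rw [← eq_inv_of_mul_eq_one_right hL]
  rfl

lemma integral_mul_zetaQuot_eq_zero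
    (hz : ∀ s : ℂ, 1 / 2 < s.re → riemannZeta s ≠ 0) {h : ℝ → ℂ} (hh : MemLp h 2 volume)
    (h0 : ∀ n : ℕ, 1 ≤ n →
      ∫ t, h t * (riemannZeta (critPoint t) / critPoint t * (n : ℂ) ^ (-critPoint t)) = 0)
    {a : ℝ} (ha0 : 0 < a) (ha : a < 3 / 4) : ∫ t, h t * zetaQuot a t = 0 := by
  by_cases ha2 : 1 / 2 < a
  · exact integral_mul_zetaQuot_eq_zero_of_half_lt hz hh h0 ha2
  obtain ⟨K, r, hr, hK⟩ := exists_norm_zetaQuot_le hz (ε := a / 2) (by linarith) (by linarith)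
  set U : Set ℂ := Set.Ioo (a / 2) (3 / 4) ×ℂ Set.Ioo (-r) r with hU
  have hUo : IsOpen U := isOpen_Ioo.reProdIm isOpen_Ioo
  have hUc : Convex ℝ U := ((convex_Ioo _ _).linear_preimage Complex.reLm).inter
    ((convex_Ioo _ _).linear_preimage Complex.imLm)
  have hUmem : ∀ x : ℝ, a / 2 < x → x < 3 / 4 → (x : ℂ) ∈ U := fun x h1 h2 => by
    rw [hU, Complex.mem_reProdIm]
    simp [h1, h2, hr]
  have hpos : ∀ w ∈ U, 0 < w.re := fun w hw => by
    have := hw.1.1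
    linarith
  have hd : DifferentiableOn ℂ (fun w => ∫ t, h t * zetaQuot w t) U := by
    refine differentiableOn_integral_of_norm_le hUo (integrable_mul_norm_critPoint_rpow hh K)
      (fun w hw => hh.1.mul (continuous_zetaQuot hz (hpos w hw)).aestronglyMeasurable)
      (fun t => ((differentiableOn_zetaQuot hz t).mono hpos).const_mul _) fun w hw t => ?_
    rw [norm_mul]
    gcongr
    exact hK w hw.1.1 hw.1.2 (abs_lt.2 hw.2) t
  have hfreq : ∃ᶠ w in nhdsWithin ((5 / 8 : ℝ) : ℂ) {((5 / 8 : ℝ) : ℂ)}ᶜ,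
      ∫ t, h t * zetaQuot w t = 0 := by
    have hT : Filter.Tendsto (fun x : ℝ => (x : ℂ)) (nhdsWithin (5 / 8) {(5 / 8 : ℝ)}ᶜ)
        (nhdsWithin ((5 / 8 : ℝ) : ℂ) {((5 / 8 : ℝ) : ℂ)}ᶜ) := by
      refine tendsto_nhdsWithin_iff.2
        ⟨(Complex.continuous_ofReal.tendsto _).mono_left nhdsWithin_le_nhds, ?_⟩
      filter_upwards [self_mem_nhdsWithin] with x hx
      exact fun h => hx (Complex.ofReal_injective h)
    refine hT.frequently (Filter.Eventually.frequently ?_)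
    filter_upwards [mem_nhdsWithin_of_mem_nhds (Ioi_mem_nhds (by norm_num : (1 / 2 : ℝ) < 5 / 8))]
      with x hx
    exact integral_mul_zetaQuot_eq_zero_of_half_lt hz hh h0 hx
  exact (hd.analyticOnNhd hUo).eqOn_zero_of_preconnected_of_frequently_eq_zero
    hUc.isPreconnected (hUmem _ (by linarith) (by norm_num)) hfreq (hUmem a (by linarith) ha)

/-- If `ζ` has no zeros to the right of the critical line, a square integrable function on that
line that annihilates every `ζ(s) n⁻ˢ / s` annihilates `1 / s`. -/
lemma integral_div_critPoint_eq_zero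
    (hz : ∀ s : ℂ, 1 / 2 < s.re → riemannZeta s ≠ 0) {h : ℝ → ℂ} (hh : MemLp h 2 volume)
    (h0 : ∀ n : ℕ, 1 ≤ n →
      ∫ t, h t * (riemannZeta (critPoint t) / critPoint t * (n : ℂ) ^ (-critPoint t)) = 0) :
    ∫ t, h t * (1 / critPoint t) = 0 := by
  obtain ⟨K, hK, hKt⟩ := exists_norm_zetaQuot_ofReal_le hz
  have hev : ∀ᶠ a : ℝ in nhdsWithin 0 (Set.Ioi 0), 0 < a ∧ a < 3 / 4 := by
    filter_upwards [Ioo_mem_nhdsGT (by norm_num : (0 : ℝ) < 3 / 4)] with a ha using ha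
  have hlim : Filter.Tendsto (fun a : ℝ => ∫ t, h t * zetaQuot a t) (nhdsWithin 0 (Set.Ioi 0))
      (nhds (∫ t, h t * (1 / critPoint t))) := by
    refine tendsto_integral_filter_of_dominated_convergence
      (fun t => ‖h t‖ * (K * ‖critPoint t‖ ^ (-(9 / 16) : ℝ))) ?_ ?_
      (integrable_mul_norm_critPoint_rpow hh K) ?_
    · filter_upwards [hev] with a ha
      exact hh.1.mul (continuous_zetaQuot hz (by simpa using ha.1)).aestronglyMeasurable
    · filter_upwards [hev] with a ha
      refine Filter.Eventually.of_forall fun t => ?_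
      rw [norm_mul]
      gcongr
      exact hKt a ha.1 ha.2.le t
    · filter_upwards [ae_zetaMulSub_critPoint_ne_zero] with t ht
      have hs : ContinuousAt zetaMulSub (critPoint t) :=
        (differentiableOn_zetaMulSub.differentiableAt
          ((Complex.continuous_re.isOpen_preimage _ isOpen_Ioi).mem_nhds
            (by simp : 0 < (critPoint t).re))).continuousAt
      have hadd : Filter.Tendsto (fun a : ℝ => critPoint t + (a : ℂ)) (nhdsWithin 0 (Set.Ioi 0))
          (nhds (critPoint t)) := by
        have h1 : Continuous fun a : ℝ => critPoint t + (a : ℂ) := by fun_prop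
        have h2 := h1.tendsto 0
        simp only [Complex.ofReal_zero, add_zero] at h2
        exact h2.mono_left nhdsWithin_le_nhds
      have h3 : Filter.Tendsto (fun a : ℝ => zetaQuot a t) (nhdsWithin 0 (Set.Ioi 0))
          (nhds (zetaMulSub (critPoint t) / zetaMulSub (critPoint t) *
            ((critPoint t - 1) / (critPoint t * (critPoint t - 1))))) :=
        (tendsto_const_nhds.div (hs.tendsto.comp hadd) ht).mul
          ((hadd.sub_const 1).div_const _)
      rw [div_self ht, one_mul, div_mul_cancel_right₀ (critPoint_sub_one_ne_zero t),
        ← one_div] at h3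
      exact h3.const_mul _
  refine tendsto_nhds_unique hlim (tendsto_const_nhds.congr' ?_)
  filter_upwards [hev] with a ha
  exact (integral_mul_zetaQuot_eq_zero hz hh h0 ha.1 ha.2).symm

open FourierTransform in
lemma fourier_toLp_ae_eq {f : ℝ → ℂ} (hf : Integrable f) (hf2 : MemLp f 2 volume) :
    ((𝓕 (hf2.toLp f) : Lp ℂ 2 (volume : Measure ℝ)) : ℝ → ℂ) =ᵐ[volume] 𝓕 f := by
  have hcont : Continuous (𝓕 f) :=
    VectorFourier.fourierIntegral_continuous Real.continuous_fourierChar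
      (L := innerₗ ℝ) continuous_inner hf
  refine ae_eq_of_integral_contDiff_smul_eq
    ((Lp.memLp _).locallyIntegrable (by norm_num)) hcont.locallyIntegrable
    fun g g_smooth g_cpt => ?_
  have hg₁ : HasCompactSupport (Complex.ofRealCLM ∘ g) := g_cpt.comp_left rfl
  have hg₂ : ContDiff ℝ (⊤ : ℕ∞) (Complex.ofRealCLM ∘ g) := by fun_prop
  set φ := hg₁.toSchwartzMap hg₂
  have h1 : Lp.toTemperedDistribution (𝓕 (hf2.toLp f)) φ =
      Lp.toTemperedDistribution (hf2.toLp f) (𝓕 φ) := by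
    rw [← Lp.fourier_toTemperedDistribution_eq, TemperedDistribution.fourier_apply]
  rw [Lp.toTemperedDistribution_apply, Lp.toTemperedDistribution_apply] at h1
  have h2 : ∫ x, (𝓕 φ) x • (hf2.toLp f : ℝ → ℂ) x = ∫ x, (𝓕 φ) x • f x := by
    refine integral_congr_ae ?_
    filter_upwards [hf2.coeFn_toLp] with x hx
    rw [hx]
  have h3 : ∫ x, (𝓕 φ) x • f x = ∫ x, φ x • (𝓕 f) x := by
    rw [SchwartzMap.fourier_coe]
    simpa using! VectorFourier.integral_fourierIntegral_smul_eq_flip (L := innerₗ ℝ)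
      Real.continuous_fourierChar continuous_inner φ.integrable hf
  have hφ : ∀ x (z : ℂ), g x • z = φ x • z := fun x z => (Complex.real_smul (x := g x) (z := z))
  simp_rw [hφ, h1, h2, h3]

/-- The substitution `x = e⁻ᵘ`, normalised to be unitary from `L²((0,∞))` to `L²(ℝ)`. -/
noncomputable def logPull (φ : ℝ → ℂ) (u : ℝ) : ℂ :=
  Real.exp (-(1 / 2) * u) • φ (Real.exp (-u))

lemma image_exp_neg : (fun u : ℝ => Real.exp (-u)) '' Set.univ = Set.Ioi 0 := by
  have : (fun u : ℝ => Real.exp (-u)) = Real.exp ∘ Neg.neg := rfl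
  rw [this, Set.image_comp, Set.image_univ_of_surjective neg_surjective, Set.image_univ,
    Real.range_exp]

lemma hasDerivWithinAt_exp_neg (u : ℝ) :
    HasDerivWithinAt (fun u : ℝ => Real.exp (-u)) (-Real.exp (-u)) Set.univ u := by
  simpa using ((hasDerivAt_id u).neg.exp).hasDerivWithinAt (s := Set.univ)

lemma injOn_exp_neg : Set.univ.InjOn fun u : ℝ => Real.exp (-u) :=
  (Real.exp_injective.comp neg_injective).injOn

lemma setIntegral_Ioi_eq_integral_exp_neg (F : ℝ → ℂ) :
    ∫ x in Set.Ioi 0, F x = ∫ u : ℝ, Real.exp (-u) • F (Real.exp (-u)) := by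
  rw [← image_exp_neg, integral_image_eq_integral_abs_deriv_smul MeasurableSet.univ
    (fun u _ => hasDerivWithinAt_exp_neg u) injOn_exp_neg]
  simp

lemma integrableOn_Ioi_iff_integrable_exp_neg {E : Type*} [NormedAddCommGroup E] [NormedSpace ℝ E]
    (F : ℝ → E) :
    IntegrableOn F (Set.Ioi 0) ↔ Integrable fun u : ℝ => Real.exp (-u) • F (Real.exp (-u)) := by
  rw [← image_exp_neg, integrableOn_image_iff_integrableOn_abs_deriv_smul MeasurableSet.univ
    (fun u _ => hasDerivWithinAt_exp_neg u) injOn_exp_neg]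
  simp

lemma exp_half_mul_self (u : ℝ) :
    Real.exp (-(1 / 2) * u) * Real.exp (-(1 / 2) * u) = Real.exp (-u) := by
  rw [← Real.exp_add]
  ring_nf

lemma setIntegral_conj_mul_eq_logPull (g f : ℝ → ℂ) :
    ∫ x in Set.Ioi 0, (starRingEnd ℂ) (g x) * f x =
      ∫ u, (starRingEnd ℂ) (logPull g u) * logPull f u := by
  rw [setIntegral_Ioi_eq_integral_exp_neg]
  congr 1 with u
  simp only [logPull, Complex.real_smul, map_mul, Complex.conj_ofReal]
  rw [← exp_half_mul_self]
  push_cast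
  ring

lemma measurable_logPull {φ : ℝ → ℂ} (hφ : Measurable φ) : Measurable (logPull φ) := by
  unfold logPull
  fun_prop

lemma memLp_logPull {φ : ℝ → ℂ} (hφ : Measurable φ)
    (h : MemLp φ 2 (volume.restrict (Set.Ioi 0))) : MemLp (logPull φ) 2 volume := by
  rw [memLp_two_iff_integrable_sq_norm (measurable_logPull hφ).aestronglyMeasurable]
  rw [memLp_two_iff_integrable_sq_norm hφ.aestronglyMeasurable] at h
  refine ((integrableOn_Ioi_iff_integrable_exp_neg _).1 h).congr
    (Filter.Eventually.of_forall fun u => ?_)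
  simp only [logPull, norm_smul, Real.norm_of_nonneg (Real.exp_pos _).le, smul_eq_mul]
  rw [← exp_half_mul_self]
  ring

lemma integrable_logPull {φ : ℝ → ℂ} (h : MellinConvergent φ (1 / 2)) :
    Integrable (logPull φ) := by
  refine ((integrableOn_Ioi_iff_integrable_exp_neg _).1 h).congr
    (Filter.Eventually.of_forall fun u => ?_)
  simp only [logPull]
  have h1 : ((Real.exp (-u) : ℝ) : ℂ) ^ ((1 / 2 : ℂ) - 1) = (Real.exp (1 / 2 * u) : ℝ) := by
    rw [show (1 / 2 : ℂ) - 1 = ((-(1 / 2) : ℝ) : ℂ) by push_cast; ring,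
      ← Complex.ofReal_cpow (Real.exp_pos _).le, ← Real.exp_mul]
    ring_nf
  rw [h1, smul_eq_mul, ← Complex.real_smul, smul_smul, ← Real.exp_add]
  ring_nf

open FourierTransform in
lemma mellin_critPoint_eq_fourier (φ : ℝ → ℂ) (t : ℝ) :
    mellin φ (critPoint t) = 𝓕 (logPull φ) t := by
  rw [mellin_eq_fourier, critPoint_re, critPoint_im, mul_div_cancel_left₀ _ (by positivity)]
  rfl

/-- The transform `G` on `L²(ℝ)` representing `g ∈ L²((0,∞))` on the critical line. -/
lemma exists_memLp_inner_eq_integral_mellin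
    (g : Lp ℂ 2 (volume.restrict (Set.Ioi (0 : ℝ)))) :
    ∃ h : ℝ → ℂ, MemLp h 2 volume ∧
      ∀ (f : Lp ℂ 2 (volume.restrict (Set.Ioi (0 : ℝ)))) (φ : ℝ → ℂ), Measurable φ →
        f =ᵐ[volume.restrict (Set.Ioi (0 : ℝ))] φ → MellinConvergent φ (1 / 2) →
        inner ℂ g f = ∫ t, h t * mellin φ (critPoint t) := by
  have hg := memLp_logPull (Lp.stronglyMeasurable g).measurable (Lp.memLp g)
  set G : Lp ℂ 2 (volume : Measure ℝ) := FourierTransform.fourier (hg.toLp) with hG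
  refine ⟨fun t => (starRingEnd ℂ) (G t), (Lp.memLp G).star, fun f φ hφ hf hmel => ?_⟩
  have hφ2 : MemLp φ 2 (volume.restrict (Set.Ioi (0 : ℝ))) := (memLp_congr_ae hf).1 (Lp.memLp f)
  have hlog := memLp_logPull hφ hφ2
  have h1 : inner ℂ g f = inner ℂ hg.toLp hlog.toLp := by
    rw [L2.inner_def, L2.inner_def]
    calc _ = ∫ x in Set.Ioi (0 : ℝ), (starRingEnd ℂ) (g x) * φ x := by
          refine integral_congr_ae ?_
          filter_upwards [hf] with x hx
          rw [hx, RCLike.inner_apply, mul_comm]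
      _ = _ := by
          rw [setIntegral_conj_mul_eq_logPull]
          refine integral_congr_ae ?_
          filter_upwards [hg.coeFn_toLp, hlog.coeFn_toLp] with x hx hx2
          rw [hx, hx2, RCLike.inner_apply, mul_comm]
  rw [h1, ← Lp.inner_fourier_eq, L2.inner_def]
  refine integral_congr_ae ?_
  filter_upwards [fourier_toLp_ae_eq (integrable_logPull hmel) hlog] with t ht
  rw [ht, RCLike.inner_apply, mul_comm, mellin_critPoint_eq_fourier]

lemma memLp_two_of_norm_le_rpow {φ : ℝ → ℂ} (hφ : Measurable φ)
    (hb : ∀ x, 0 < x → ‖φ x‖ ≤ x ^ (-(1 / 2) : ℝ)) (hm : MellinConvergent φ (1 / 2)) :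
    MemLp φ 2 (volume.restrict (Set.Ioi (0 : ℝ))) := by
  rw [memLp_two_iff_integrable_sq_norm hφ.aestronglyMeasurable]
  refine Integrable.mono' hm.norm (by fun_prop) ?_
  filter_upwards [ae_restrict_mem measurableSet_Ioi] with x (hx : 0 < x)
  rw [norm_smul, Complex.norm_cpow_eq_rpow_re_of_pos hx, Real.norm_of_nonneg (by positivity), sq]
  have : ((1 / 2 : ℂ) - 1).re = -(1 / 2) := by norm_num
  rw [this]
  gcongr
  exact hb x hx

lemma RiemannHypothesis.riemannZeta_ne_zero_of_half_lt_re (hRH : RiemannHypothesis) (s : ℂ)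
    (hs : 1 / 2 < s.re) : riemannZeta s ≠ 0 := by
  intro h0
  rcases le_or_gt 1 s.re with h1 | h1
  · exact riemannZeta_ne_zero_of_one_le_re h1 h0
  · have := hRH s h0 ?_ ?_
    · linarith
    · rintro ⟨n, rfl⟩
      norm_num at hs
      have : (0 : ℝ) ≤ n := n.cast_nonneg
      linarith
    · rintro rfl
      norm_num at h1

lemma norm_fract_inv_mul_le {n : ℕ} (hn : 1 ≤ n) {x : ℝ} (hx : 0 < x) :
    ‖((Int.fract (1 / (n * x)) : ℝ) : ℂ)‖ ≤ x ^ (-(1 / 2) : ℝ) := by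
  rw [Complex.norm_real, Real.norm_of_nonneg (Int.fract_nonneg _)]
  have hn' : (1 : ℝ) ≤ n := by exact_mod_cast hn
  rcases le_or_gt x 1 with h1 | h1
  · exact (Int.fract_lt_one _).le.trans
      (Real.one_le_rpow_of_pos_of_le_one_of_nonpos hx h1 (by norm_num))
  · calc Int.fract (1 / (n * x)) ≤ 1 / (n * x) :=
          sub_le_self _ (by exact_mod_cast Int.floor_nonneg.2 (by positivity))
      _ ≤ 1 / x := by gcongr; nlinarith
      _ = x ^ (-1 : ℝ) := by rw [Real.rpow_neg_one, one_div]
      _ ≤ _ := Real.rpow_le_rpow_of_exponent_le h1.le (by norm_num)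

lemma measurable_fract_inv_mul (n : ℕ) :
    Measurable fun x : ℝ => ((Int.fract (1 / (n * x)) : ℝ) : ℂ) := by
  fun_prop

lemma mellinConvergent_fract_inv_mul {n : ℕ} (hn : 1 ≤ n) :
    MellinConvergent (fun x : ℝ => ((Int.fract (1 / (n * x)) : ℝ) : ℂ)) (1 / 2) :=
  (hasMellin_fract_inv_mul (by norm_num) (by norm_num) hn).1

lemma memLp_fract_inv_mul {n : ℕ} (hn : 1 ≤ n) :
    MemLp (fun x : ℝ => ((Int.fract (1 / (n * x)) : ℝ) : ℂ)) 2
      (volume.restrict (Set.Ioi (0 : ℝ))) :=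
  memLp_two_of_norm_le_rpow (measurable_fract_inv_mul n)
    (fun _ => norm_fract_inv_mul_le hn) (mellinConvergent_fract_inv_mul hn)

lemma indicator_Icc_ae_eq_indicator_Ioc :
    (Set.Icc (0 : ℝ) 1).indicator (fun _ => (1 : ℂ)) =ᵐ[volume.restrict (Set.Ioi (0 : ℝ))]
      (Set.Ioc (0 : ℝ) 1).indicator fun _ => (1 : ℂ) :=
  (indicator_ae_eq_of_ae_eq_set (Ioc_ae_eq_Icc.symm)).filter_mono
    (ae_mono Measure.restrict_le_self)

/-- The closed-span membership follows from the nonvanishing of `ζ` on `re s > 1 / 2`. -/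
lemma indicator_mem_closedSpan_of_riemannZeta_ne_zero
    (hz : ∀ s : ℂ, 1 / 2 < s.re → riemannZeta s ≠ 0)
    {χ : Lp ℂ 2 (volume.restrict (Set.Ioi (0 : ℝ)))}
    (hχ : χ =ᵐ[volume.restrict (Set.Ioi (0 : ℝ))] (Set.Ioc (0 : ℝ) 1).indicator fun _ => (1 : ℂ)) :
    χ ∈ closure (↑(Submodule.span ℂ
      {g : Lp ℂ 2 (volume.restrict (Set.Ioi (0 : ℝ))) | ∃ n : ℕ, 1 ≤ n ∧
        (g : ℝ → ℂ) =ᵐ[volume.restrict (Set.Ioi (0 : ℝ))]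
          fun x => ((Int.fract (1 / (n * x)) : ℝ) : ℂ)}) :
      Set (Lp ℂ 2 (volume.restrict (Set.Ioi (0 : ℝ))))) := by
  rw [← Submodule.topologicalClosure_coe, SetLike.mem_coe,
    ← Submodule.orthogonal_orthogonal_eq_closure, Submodule.mem_orthogonal]
  intro g hg
  obtain ⟨h, hh, hinner⟩ := exists_memLp_inner_eq_integral_mellin g
  have hone : ∀ s : ℂ, 0 < s.re →
      HasMellin ((Set.Ioc (0 : ℝ) 1).indicator fun _ => (1 : ℂ)) s (1 / s) :=
    fun s hs => hasMellin_one_Ioc hs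
  rw [hinner χ _ (measurable_const.indicator measurableSet_Ioc) hχ (hone _ (by norm_num)).1]
  have h1 : ∀ t, mellin ((Set.Ioc (0 : ℝ) 1).indicator fun _ => (1 : ℂ)) (critPoint t) =
      1 / critPoint t := fun t => (hone _ (by simp)).2
  simp_rw [h1]
  refine integral_div_critPoint_eq_zero hz hh fun n hn => ?_
  have h2 : inner ℂ g (memLp_fract_inv_mul hn).toLp = 0 :=
    (Submodule.mem_orthogonal' _ _).1 hg _
      (Submodule.subset_span ⟨n, hn, (memLp_fract_inv_mul hn).coeFn_toLp⟩)
  rw [hinner _ _ (measurable_fract_inv_mul n) (memLp_fract_inv_mul hn).coeFn_toLp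
    (mellinConvergent_fract_inv_mul hn)] at h2
  rw [← neg_eq_zero, ← integral_neg, ← h2]
  congr 1 with t
  rw [(hasMellin_fract_inv_mul (by simp) (by norm_num) hn).2]
  ring

/-- The kernel `x ^ (s - 1)` on `(0,1]`, corrected on `(1,∞)` so that it is square integrable but
still computes the Mellin transform at `s` of functions proportional to `1 / x` on `(1,∞)`. -/
noncomputable def truncMellinKernel (s : ℂ) (x : ℝ) : ℂ :=
  if x ≤ 1 then (x : ℂ) ^ (s - 1) else (1 - s)⁻¹ * (x : ℂ) ^ (-1 : ℂ)

lemma measurable_truncMellinKernel (s : ℂ) : Measurable (truncMellinKernel s) := by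
  unfold truncMellinKernel
  exact Measurable.ite measurableSet_Iic (by fun_prop) (by fun_prop)

lemma memLp_truncMellinKernel {s : ℂ} (hs : 1 / 2 < s.re) :
    MemLp (truncMellinKernel s) 2 (volume.restrict (Set.Ioi (0 : ℝ))) := by
  rw [memLp_two_iff_integrable_sq_norm (measurable_truncMellinKernel s).aestronglyMeasurable,
    ← Set.Ioc_union_Ioi_eq_Ioi zero_le_one]
  refine IntegrableOn.union ?_ ?_
  · have h := (intervalIntegral.intervalIntegrable_rpow' (a := 0) (b := 1)
      (r := 2 * (s.re - 1)) (by linarith)).1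
    refine h.congr_fun (fun x hx => ?_) measurableSet_Ioc
    simp only [truncMellinKernel, if_pos hx.2]
    rw [Complex.norm_cpow_eq_rpow_re_of_pos hx.1, ← Real.rpow_natCast, ← Real.rpow_mul hx.1.le]
    simp [mul_comm]
  · have h : IntegrableOn _ _ _ :=
      (integrableOn_Ioi_rpow_of_lt (a := -2) (by norm_num) one_pos).const_mul (‖(1 - s)⁻¹‖ ^ 2)
    refine h.congr_fun (fun x (hx : 1 < x) => ?_) measurableSet_Ioi
    simp only [truncMellinKernel, if_neg hx.not_ge, norm_mul, mul_pow]
    rw [Complex.norm_cpow_eq_rpow_re_of_pos (by linarith), ← Real.rpow_natCast (x ^ _),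
      ← Real.rpow_mul (by linarith)]
    simp

lemma setIntegral_truncMellinKernel_mul_fract_inv_mul {s : ℂ} (hs : 0 < s.re) (hs1 : s.re < 1)
    {n : ℕ} (hn : 1 ≤ n) :
    ∫ x in Set.Ioi (0 : ℝ), truncMellinKernel s x * ((Int.fract (1 / (n * x)) : ℝ) : ℂ) =
      -riemannZeta s / s * (n : ℂ) ^ (-s) := by
  have hn' : (1 : ℝ) ≤ n := by exact_mod_cast hn
  have hs1' : 1 - s ≠ 0 := fun h => by
    have := congrArg Complex.re h
    simp at this
    linarith
  have hfr : ∀ x : ℝ, 1 < x →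
      ((Int.fract (1 / (n * x)) : ℝ) : ℂ) = (n : ℂ)⁻¹ * (x : ℂ) ^ (-1 : ℂ) := by
    intro x hx
    rw [Int.fract_eq_self.2 ⟨by positivity, by rw [div_lt_one (by positivity)]; nlinarith⟩,
      Complex.cpow_neg_one]
    push_cast
    rw [one_div, mul_inv]
  have hsplit : ∀ z : ℂ, ∀ x : ℝ, 1 < x →
      (x : ℂ) ^ z * ((Int.fract (1 / (n * x)) : ℝ) : ℂ) = (n : ℂ)⁻¹ * (x : ℂ) ^ (z - 1) := by
    intro z x hx
    have hx0 : (x : ℂ) ≠ 0 := by exact_mod_cast (by linarith : x ≠ 0)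
    rw [hfr x hx, sub_eq_add_neg, Complex.cpow_add _ _ hx0]
    ring
  have hmel := hasMellin_fract_inv_mul hs hs1 hn
  rw [← hmel.2, mellin]
  have hconv : IntegrableOn (fun x : ℝ => (x : ℂ) ^ (s - 1) •
    ((Int.fract (1 / (n * x)) : ℝ) : ℂ)) (Set.Ioi 0) := hmel.1
  have hleft : ∀ x ∈ Set.Ioc (0 : ℝ) 1, (x : ℂ) ^ (s - 1) • ((Int.fract (1 / (n * x)) : ℝ) : ℂ) =
      truncMellinKernel s x * ((Int.fract (1 / (n * x)) : ℝ) : ℂ) := fun x hx => by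
    rw [truncMellinKernel, if_pos hx.2, smul_eq_mul]
  have hright : ∀ x ∈ Set.Ioi (1 : ℝ),
      truncMellinKernel s x * ((Int.fract (1 / (n * x)) : ℝ) : ℂ) =
        ((1 - s)⁻¹ * (n : ℂ)⁻¹) * (x : ℂ) ^ (-2 : ℂ) := fun x (hx : 1 < x) => by
    rw [truncMellinKernel, if_neg hx.not_ge, mul_assoc, hsplit _ x hx]
    norm_num
    ring
  have hright' : ∀ x ∈ Set.Ioi (1 : ℝ), (x : ℂ) ^ (s - 1) • ((Int.fract (1 / (n * x)) : ℝ) : ℂ) =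
      (n : ℂ)⁻¹ * (x : ℂ) ^ (s - 2) := fun x (hx : 1 < x) => by
    rw [smul_eq_mul, hsplit _ x hx]
    ring_nf
  have htail : IntegrableOn (fun x : ℝ => ((1 - s)⁻¹ * (n : ℂ)⁻¹) * (x : ℂ) ^ (-2 : ℂ))
    (Set.Ioi 1) := (integrableOn_Ioi_cpow_of_lt (by norm_num) one_pos).const_mul _
  rw [← Set.Ioc_union_Ioi_eq_Ioi zero_le_one] at hconv ⊢
  rw [setIntegral_union Set.Ioc_disjoint_Ioi_same measurableSet_Ioi
      (hconv.left_of_union.congr_fun hleft measurableSet_Ioc)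
      (htail.congr_fun (fun x hx => (hright x hx).symm) measurableSet_Ioi),
    setIntegral_union Set.Ioc_disjoint_Ioi_same measurableSet_Ioi
      hconv.left_of_union hconv.right_of_union,
    setIntegral_congr_fun measurableSet_Ioc hleft, setIntegral_congr_fun measurableSet_Ioi hright,
    setIntegral_congr_fun measurableSet_Ioi hright', integral_const_mul, integral_const_mul,
    integral_Ioi_cpow_of_lt (by norm_num) one_pos,
    integral_Ioi_cpow_of_lt (by simp; linarith) one_pos]
  simp only [Complex.ofReal_one, Complex.one_cpow]
  have : s - 2 + 1 = -(1 - s) := by ring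
  rw [this]
  field_simp
  norm_num
  ring

lemma setIntegral_truncMellinKernel_mul_indicator {s : ℂ} (hs : 0 < s.re) :
    ∫ x in Set.Ioi (0 : ℝ), truncMellinKernel s x * (Set.Ioc (0 : ℝ) 1).indicator (fun _ => 1) x =
      1 / s := by
  rw [← (hasMellin_one_Ioc hs).2, mellin]
  congr 1 with x
  by_cases hx : x ∈ Set.Ioc (0 : ℝ) 1
  · simp [hx, truncMellinKernel, hx.2]
  · simp [hx]

lemma riemannZeta_ne_zero_of_indicator_mem_closedSpan
    {χ : Lp ℂ 2 (volume.restrict (Set.Ioi (0 : ℝ)))}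
    (hχ : χ =ᵐ[volume.restrict (Set.Ioi (0 : ℝ))] (Set.Ioc (0 : ℝ) 1).indicator fun _ => (1 : ℂ))
    (hmem : χ ∈ closure (↑(Submodule.span ℂ
      {g : Lp ℂ 2 (volume.restrict (Set.Ioi (0 : ℝ))) | ∃ n : ℕ, 1 ≤ n ∧
        (g : ℝ → ℂ) =ᵐ[volume.restrict (Set.Ioi (0 : ℝ))]
          fun x => ((Int.fract (1 / (n * x)) : ℝ) : ℂ)}) :
      Set (Lp ℂ 2 (volume.restrict (Set.Ioi (0 : ℝ))))))
    {s : ℂ} (hs : 1 / 2 < s.re) (hs1 : s.re < 1) : riemannZeta s ≠ 0 := by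
  intro h0
  have hs0 : 0 < s.re := by linarith
  have hw := (memLp_truncMellinKernel hs).star
  have hinner : ∀ (f : Lp ℂ 2 (volume.restrict (Set.Ioi (0 : ℝ)))) (φ : ℝ → ℂ),
      f =ᵐ[volume.restrict (Set.Ioi (0 : ℝ))] φ →
      inner ℂ hw.toLp f = ∫ x in Set.Ioi (0 : ℝ), truncMellinKernel s x * φ x := by
    intro f φ hf
    rw [L2.inner_def]
    refine integral_congr_ae ?_
    filter_upwards [hf, hw.coeFn_toLp] with x hx hx2
    rw [hx, hx2, RCLike.inner_apply, mul_comm]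
    simp
  have hK : Submodule.span ℂ {g : Lp ℂ 2 (volume.restrict (Set.Ioi (0 : ℝ))) | ∃ n : ℕ, 1 ≤ n ∧
        (g : ℝ → ℂ) =ᵐ[volume.restrict (Set.Ioi (0 : ℝ))]
          fun x => ((Int.fract (1 / (n * x)) : ℝ) : ℂ)} ≤ (ℂ ∙ hw.toLp)ᗮ := by
    rw [Submodule.span_le]
    rintro g ⟨n, hn, hg⟩
    rw [SetLike.mem_coe, Submodule.mem_orthogonal_singleton_iff_inner_right, hinner g _ hg,
      setIntegral_truncMellinKernel_mul_fract_inv_mul hs0 hs1 hn, h0]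
    simp
  have h1 := closure_minimal hK (Submodule.isClosed_orthogonal _) hmem
  rw [SetLike.mem_coe, Submodule.mem_orthogonal_singleton_iff_inner_right, hinner χ _ hχ,
    setIntegral_truncMellinKernel_mul_indicator hs0, one_div, inv_eq_zero] at h1
  simp [h1] at hs0

lemma riemannHypothesis_of_riemannZeta_ne_zero
    (hz : ∀ s : ℂ, 1 / 2 < s.re → s.re < 1 → riemannZeta s ≠ 0) : RiemannHypothesis := by
  have hhalf : ∀ s : ℂ, 1 / 2 < s.re → riemannZeta s ≠ 0 := fun s hs =>
    (lt_or_ge s.re 1).elim (hz s hs) fun h => riemannZeta_ne_zero_of_one_le_re h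
  intro s hs htriv hs1
  by_contra hne
  rcases lt_or_gt_of_ne hne with hlt | hgt
  · have hs0 : s ≠ 0 := by
      rintro rfl
      norm_num [riemannZeta_zero] at hs
    rw [riemannZeta_def_of_ne_zero hs0, div_eq_zero_iff] at hs
    rcases hs with hs | hs
    · have h1s : (1 - s) ≠ 0 := sub_ne_zero.2 hs1.symm
      refine hhalf (1 - s) (by simp; linarith) ?_
      rw [riemannZeta_def_of_ne_zero h1s, completedRiemannZeta_one_sub, hs, zero_div]
    · obtain ⟨n, hn⟩ := Complex.Gammaℝ_eq_zero_iff.1 hs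
      rcases n with _ | n
      · simp at hn
        exact hs0 hn
      · exact htriv ⟨n, by rw [hn]; push_cast; ring⟩
  · exact hhalf s hgt hs

/-- **Nyman–Beurling–Báez-Duarte criterion.**
The Riemann hypothesis holds if and only if the indicator function of `[0,1]` belongs to
the closed linear span in `L²((0,∞))` of the dilations `x ↦ {1/(n x)}`, `n ≥ 1`, of the
fractional-part function `ρ(x) = {1/x}`. -/
theorem riemannHypothesis_iff_indicator_mem_closedSpan_dilations
    (μ : Measure ℝ) (hμ : μ = volume.restrict (Set.Ioi (0 : ℝ)))
    (χ : Lp ℂ 2 μ)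
    (hχ : (χ : ℝ → ℂ) =ᵐ[μ] fun x => Set.indicator (Set.Icc (0 : ℝ) 1) (fun _ => (1 : ℂ)) x) :
    RiemannHypothesis ↔
      χ ∈ closure (↑(Submodule.span ℂ
        {g : Lp ℂ 2 μ | ∃ n : ℕ, 1 ≤ n ∧
          (g : ℝ → ℂ) =ᵐ[μ] fun x => ((Int.fract (1 / (n * x)) : ℝ) : ℂ)}) : Set (Lp ℂ 2 μ)) := by
  subst hμ
  have hχ' := hχ.trans indicator_Icc_ae_eq_indicator_Ioc
  exact ⟨fun hRH => indicator_mem_closedSpan_of_riemannZeta_ne_zero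
      hRH.riemannZeta_ne_zero_of_half_lt_re hχ',
    fun hmem => riemannHypothesis_of_riemannZeta_ne_zero fun _ =>
      riemannZeta_ne_zero_of_indicator_mem_closedSpan hχ' hmem⟩
end

section
/- Let X be a Banach space of analytic functions on an open set Ω ⊆ ℂ^d, let P be an analytic polynomial in d variables (regarded as an element of X), and let f ∈ X. Then Pf is shift-cyclic if and only if both P and f are shift-cyclic. Consequently, a polynomial is shift-cyclic in X if and only if all of its irreducible factors are shift-cyclic in X. -/
/-- A Banach space of analytic functions on an open set `Ω ⊆ ℂ^d`: a complex Banach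
space `X` whose elements are (identified with, via the injective-on-`Ω` linear map `val`)
holomorphic functions on `Ω`, satisfying (P1) the polynomials belong to `X` and are dense,
(P2) point evaluations at points of `Ω` are bounded linear functionals, and (P3) the
coordinate shift operators `f ↦ z_j · f` map `X` into itself. -/
structure IsBanachSpaceOfAnalyticFunctions (d : ℕ) (Ω : Set (Fin d → ℂ)) (X : Type*)
    [NormedAddCommGroup X] [NormedSpace ℂ X] [CompleteSpace X]
    (val : X →ₗ[ℂ] ((Fin d → ℂ) → ℂ)) : Prop where
  eqOn_inj : ∀ f g : X, Set.EqOn (val f) (val g) Ω → f = g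
  holo : ∀ f : X, DifferentiableOn ℂ (val f) Ω
  poly_mem : ∀ P : MvPolynomial (Fin d) ℂ,
    ∃ p : X, Set.EqOn (val p) (fun w => MvPolynomial.eval w P) Ω
  poly_dense : Dense {p : X | ∃ P : MvPolynomial (Fin d) ℂ,
    Set.EqOn (val p) (fun w => MvPolynomial.eval w P) Ω}
  eval_bdd : ∀ w ∈ Ω, ∃ L : X →L[ℂ] ℂ, ∀ f : X, L f = val f w
  shift_mem : ∀ (j : Fin d) (f : X),
    ∃ g : X, Set.EqOn (val g) (fun w => w j * val f w) Ω

/-- `S[f] = X`: the polynomial multiples of `f` are dense in `X`. -/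
def ShiftCyclic {d : ℕ} (Ω : Set (Fin d → ℂ)) {X : Type*}
    [NormedAddCommGroup X] [NormedSpace ℂ X] [CompleteSpace X]
    (val : X →ₗ[ℂ] ((Fin d → ℂ) → ℂ)) (f : X) : Prop :=
  closure {g : X | ∃ P : MvPolynomial (Fin d) ℂ,
    Set.EqOn (val g) (fun w => MvPolynomial.eval w P * val f w) Ω} = Set.univ

/-- If the orbit of `e` under a commutative monoid of operators is dense, then `a • f` has dense
orbit iff both `a • e` and `f` do. -/
theorem denseRange_map_apply_iff {A X : Type*} [CommMonoid A] [NormedAddCommGroup X]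
    [NormedSpace ℂ X] (M : A →* (X →L[ℂ] X)) {e : X} (he : DenseRange fun b => M b e)
    (a : A) (f : X) :
    (DenseRange fun b => M b (M a f)) ↔
      (DenseRange fun b => M b (M a e)) ∧ DenseRange fun b => M b f := by
  have hcomm (b c : A) (x : X) : M b (M c x) = M c (M b x) := by
    have h : M b * M c = M c * M b := by rw [← map_mul, ← map_mul, mul_comm]
    exact DFunLike.congr_fun h x
  have hmul (b c : A) (x : X) : M (b * c) x = M b (M c x) := by simp
  refine ⟨fun h => ⟨?_, ?_⟩, fun ⟨h₁, h₂⟩ => ?_⟩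
  · refine dense_closure.1 (h.mono ?_)
    rintro _ ⟨b, rfl⟩
    dsimp only
    rw [← hmul]
    refine map_mem_closure (M (b * a)).continuous (he f) ?_
    rintro _ ⟨c, rfl⟩
    exact ⟨b * c, by simp only [hmul, hcomm a c]⟩
  · refine h.mono ?_
    rintro _ ⟨b, rfl⟩
    exact ⟨b * a, hmul b a f⟩
  · refine dense_closure.1 (h₁.mono ?_)
    rintro _ ⟨b, rfl⟩
    dsimp only
    rw [hcomm]
    refine map_mem_closure (M a).continuous (h₂ (M b e)) ?_
    rintro _ ⟨c, rfl⟩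
    exact ⟨c, hcomm c a f⟩

namespace IsBanachSpaceOfAnalyticFunctions

variable {d : ℕ} {Ω : Set (Fin d → ℂ)} {X : Type*} [NormedAddCommGroup X] [NormedSpace ℂ X]
  [CompleteSpace X] {val : X →ₗ[ℂ] ((Fin d → ℂ) → ℂ)}

/-- The coordinate shift is a bounded operator, by the closed graph theorem. -/
theorem exists_shift (hX : IsBanachSpaceOfAnalyticFunctions d Ω X val) (j : Fin d) :
    ∃ S : X →L[ℂ] X, ∀ f, ∀ w ∈ Ω, val (S f) w = w j * val f w := by
  choose s hs using hX.shift_mem j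
  let S : X →ₗ[ℂ] X :=
    { toFun := s
      map_add' := fun f g => hX.eqOn_inj _ _ fun w hw => by
        simp only [map_add, Pi.add_apply, hs _ hw, mul_add]
      map_smul' := fun c f => hX.eqOn_inj _ _ fun w hw => by
        simp only [map_smul, Pi.smul_apply, hs _ hw, smul_eq_mul, RingHom.id_apply]
        ring }
  refine ⟨⟨S, S.continuous_of_seq_closed_graph fun u x y hu hSu => ?_⟩, fun f w hw => hs f hw⟩
  refine hX.eqOn_inj _ _ fun w hw => ?_
  obtain ⟨L, hL⟩ := hX.eval_bdd w hw
  have h₁ := (L.continuous.tendsto y).comp hSu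
  have h₂ := ((L.continuous.tendsto x).comp hu).const_mul (w j)
  have h₃ : (L ∘ S ∘ u) = fun n => w j * (L ∘ u) n :=
    funext fun n => by
      simp only [Function.comp_apply, hL]
      exact hs (u n) hw
  rw [h₃] at h₁
  have h₄ := tendsto_nhds_unique h₁ h₂
  rw [hL, hL] at h₄
  exact h₄.trans (hs x hw).symm

/-- Multiplication by a polynomial is a bounded operator. -/
theorem exists_polynomial_mul (hX : IsBanachSpaceOfAnalyticFunctions d Ω X val)
    (P : MvPolynomial (Fin d) ℂ) :
    ∃ T : X →L[ℂ] X, ∀ f, ∀ w ∈ Ω, val (T f) w = MvPolynomial.eval w P * val f w := by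
  induction P using MvPolynomial.induction_on with
  | C c => exact ⟨c • ContinuousLinearMap.id ℂ X, fun f w _ => by simp⟩
  | add P Q hP hQ =>
    obtain ⟨S, hS⟩ := hP
    obtain ⟨T, hT⟩ := hQ
    exact ⟨S + T, fun f w hw => by simp [hS f w hw, hT f w hw, add_mul]⟩
  | mul_X P j hP =>
    obtain ⟨S, hS⟩ := hP
    obtain ⟨T, hT⟩ := hX.exists_shift j
    exact ⟨S * T, fun f w hw => by simp [hS _ w hw, hT f w hw, mul_assoc]⟩

/-- The polynomials act on `X` by bounded multiplication operators. -/
theorem exists_polynomial_mulHom (hX : IsBanachSpaceOfAnalyticFunctions d Ω X val) :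
    ∃ M : MvPolynomial (Fin d) ℂ →* (X →L[ℂ] X),
      ∀ P f, Set.EqOn (val (M P f)) (fun w => MvPolynomial.eval w P * val f w) Ω := by
  choose M hM using hX.exists_polynomial_mul
  refine ⟨⟨⟨M, ?_⟩, fun P Q => ?_⟩, hM⟩
  · ext f
    exact hX.eqOn_inj _ _ fun w hw => by simp [hM _ _ w hw]
  · ext f
    exact hX.eqOn_inj _ _ fun w hw => by simp [hM _ _ w hw, mul_assoc]

end IsBanachSpaceOfAnalyticFunctions

/-- For a polynomial `P` (regarded as an element `p` of `X`) and `f ∈ X`,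
the product `Pf` is shift-cyclic iff both `P` and `f` are shift-cyclic; consequently a
(nonzero) polynomial is shift-cyclic iff all of its irreducible factors are shift-cyclic. -/
theorem shiftCyclic_poly_mul_iff (d : ℕ) (hd : 0 < d) (Ω : Set (Fin d → ℂ)) (hΩ : IsOpen Ω)
    (X : Type*) [NormedAddCommGroup X] [NormedSpace ℂ X] [CompleteSpace X]
    (val : X →ₗ[ℂ] ((Fin d → ℂ) → ℂ))
    (hX : IsBanachSpaceOfAnalyticFunctions d Ω X val) :
    (∀ (P : MvPolynomial (Fin d) ℂ) (p f pf : X),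
      Set.EqOn (val p) (fun w => MvPolynomial.eval w P) Ω →
      Set.EqOn (val pf) (fun w => MvPolynomial.eval w P * val f w) Ω →
      (ShiftCyclic Ω val pf ↔ ShiftCyclic Ω val p ∧ ShiftCyclic Ω val f)) ∧
    (∀ P : MvPolynomial (Fin d) ℂ, P ≠ 0 → ∀ p : X,
      Set.EqOn (val p) (fun w => MvPolynomial.eval w P) Ω →
      (ShiftCyclic Ω val p ↔
        ∀ Q : MvPolynomial (Fin d) ℂ, Irreducible Q → Q ∣ P → ∀ q : X,
          Set.EqOn (val q) (fun w => MvPolynomial.eval w Q) Ω → ShiftCyclic Ω val q)) := by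
  obtain ⟨M, hM⟩ := hX.exists_polynomial_mulHom
  have cyclic_iff (f : X) : ShiftCyclic Ω val f ↔ DenseRange fun P => M P f := by
    rw [ShiftCyclic, DenseRange, dense_iff_closure_eq]
    congr! 2
    ext g
    exact ⟨fun ⟨P, hP⟩ => ⟨P, hX.eqOn_inj _ _ ((hM P f).trans hP.symm)⟩,
      fun ⟨P, hP⟩ => ⟨P, hP ▸ hM P f⟩⟩
  obtain ⟨e, he⟩ := hX.poly_mem 1
  have eq_apply {P : MvPolynomial (Fin d) ℂ} {p : X}
      (hp : Set.EqOn (val p) (fun w => MvPolynomial.eval w P) Ω) : p = M P e :=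
    hX.eqOn_inj _ _ fun w hw => by simp [hp hw, hM P e hw, he hw]
  have dense_e : DenseRange fun P => M P e :=
    hX.poly_dense.mono (by rintro p ⟨P, hP⟩; exact ⟨P, (eq_apply hP).symm⟩)
  have mul_iff (P : MvPolynomial (Fin d) ℂ) (f : X) : ShiftCyclic Ω val (M P f) ↔
      ShiftCyclic Ω val (M P e) ∧ ShiftCyclic Ω val f := by
    simpa only [cyclic_iff] using denseRange_map_apply_iff M dense_e P f
  have val_apply (P : MvPolynomial (Fin d) ℂ) :
      Set.EqOn (val (M P e)) (fun w => MvPolynomial.eval w P) Ω :=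
    fun w hw => by simp [hM P e hw, he hw]
  refine ⟨fun P p f pf hp hpf => ?_, fun P hP p hp => ?_⟩
  · rw [hX.eqOn_inj pf (M P f) (hpf.trans (hM P f).symm), eq_apply hp]
    exact mul_iff P f
  rw [eq_apply hp]
  refine ⟨?_, fun h => ?_⟩
  · rintro h Q - ⟨R, rfl⟩ q hq
    rw [eq_apply hq]
    rw [map_mul] at h
    exact ((mul_iff Q (M R e)).1 h).1
  · clear hp p
    induction P using WfDvdMonoid.induction_on_irreducible with
    | zero => exact absurd rfl hP
    | unit u hu =>
      obtain ⟨v, hv⟩ := hu.exists_left_inv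
      have h_e : ShiftCyclic Ω val (M (v * u) e) := by
        rw [hv, cyclic_iff]
        simpa using dense_e
      rw [mul_comm, map_mul] at h_e
      exact ((mul_iff u (M v e)).1 h_e).1
    | mul a i ha hi ih =>
      rw [map_mul]
      exact (mul_iff i (M a e)).2 ⟨h i hi (dvd_mul_right i a) _ (val_apply i),
        ih ha fun Q hQ hQa => h Q hQ (hQa.mul_left i)⟩
end

section
/- Let (c_k)_{k≥0} be real numbers with c₀ = 1, c_k > 0 for all k ≥ 1, and c_k/c_{k−1} ≤ c_{k+1}/c_k for all k ≥ 1, and suppose that ∑_{k≥0} c_k r^k < ∞ for every 0 ≤ r < 1, so that K(z,w) := ∑_{k≥0} c_k z^k (conj w)^k converges for all z, w in the open unit disk 𝔻. Then K(z,w) ≠ 0 for all z, w ∈ 𝔻, and the kernel (z,w) ↦ 1 − 1/K(z,w) is positive semidefinite on 𝔻. -/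
open ComplexOrder

/-- Kaluza's lemma for sequences: if `c` is positive with nondecreasing ratios, the solution `e` of
the renewal equation `c (n + 1) = ∑ k ≤ n, e k * c (n - k)` is nonnegative. -/
theorem nonneg_of_renewal {c e : ℕ → ℝ} (hc : ∀ k, 0 < c k)
    (hratio : ∀ k, c (k + 1) / c k ≤ c (k + 2) / c (k + 1))
    (he : ∀ n, ∑ k ∈ Finset.range (n + 1), e k * c (n - k) = c (n + 1)) (n : ℕ) : 0 ≤ e n := by
  have hmono : Monotone fun k => c (k + 1) / c k := monotone_nat_of_le_succ hratio
  induction n using Nat.strong_induction_on with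
  | _ n ih =>
    rcases n with _ | n
    · have h := he 0
      simp only [zero_add, Finset.sum_range_one, Nat.sub_zero] at h
      exact (pos_of_mul_pos_left (h ▸ hc 1) (hc 0).le).le
    · have h1 := he (n + 1)
      rw [Finset.sum_range_succ, Nat.sub_self] at h1
      have h2 : ∑ k ∈ Finset.range (n + 1), e k * c (n + 1 - k) * c (n + 1) ≤
          ∑ k ∈ Finset.range (n + 1), e k * c (n - k) * c (n + 2) := by
        refine Finset.sum_le_sum fun k hk => ?_
        have hk' : k < n + 1 := Finset.mem_range.mp hk
        rw [mul_assoc, mul_assoc, Nat.sub_add_comm (Nat.lt_succ_iff.mp hk')]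
        refine mul_le_mul_of_nonneg_left ?_ (ih k hk')
        have h := hmono (Nat.sub_le n k)
        have := (div_le_div_iff₀ (hc _) (hc _)).mp (h.trans (hratio n))
        linarith
      rw [← Finset.sum_mul, ← Finset.sum_mul, he n] at h2
      have h3 : 0 ≤ e (n + 1) * (c 0 * c (n + 1)) := by
        have := congrArg (· * c (n + 1)) h1
        simp only [add_mul] at this
        nlinarith
      exact nonneg_of_mul_nonneg_left h3 (mul_pos (hc 0) (hc _))

/-- A sequence with `c 0 = 1` has a convolution inverse. -/
theorem exists_conv_inverse (c : ℕ → ℝ) (h0 : c 0 = 1) : ∃ d : ℕ → ℝ, d 0 = 1 ∧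
    ∀ n, ∑ p ∈ Finset.HasAntidiagonal.antidiagonal n, d p.1 * c p.2 = if n = 0 then 1 else 0 := by
  have hC : PowerSeries.constantCoeff (PowerSeries.mk c) ≠ 0 := by simp [h0]
  refine ⟨fun n => PowerSeries.coeff n (PowerSeries.mk c)⁻¹, by simp [h0], fun n => ?_⟩
  have h := congrArg (PowerSeries.coeff n) (PowerSeries.inv_mul_cancel _ hC)
  simpa [PowerSeries.coeff_mul, PowerSeries.coeff_one] using h

/-- The reciprocal of a power series with `c 0 = 1` and nondecreasing coefficient ratios is
`1 - ∑ e k t ^ (k + 1)` on the unit disk, with `e k ≥ 0`. -/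
theorem exists_nonneg_reciprocal {c : ℕ → ℝ} (h0 : c 0 = 1) (hc : ∀ k, 0 < c k)
    (hratio : ∀ k, c (k + 1) / c k ≤ c (k + 2) / c (k + 1))
    (hsum : ∀ r : ℝ, 0 ≤ r → r < 1 → Summable fun k : ℕ => c k * r ^ k) :
    ∃ e : ℕ → ℝ, (∀ k, 0 ≤ e k) ∧ ∀ t : ℂ, ‖t‖ < 1 →
      (Summable fun k : ℕ => (e k : ℂ) * t ^ (k + 1)) ∧
      (1 - ∑' k : ℕ, (e k : ℂ) * t ^ (k + 1)) * ∑' k : ℕ, (c k : ℂ) * t ^ k = 1 := by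
  obtain ⟨d, hd0, hd⟩ := exists_conv_inverse c h0
  have hren : ∀ n, ∑ k ∈ Finset.range (n + 1), -d (k + 1) * c (n - k) = c (n + 1) := by
    intro n
    have h := hd (n + 1)
    rw [Finset.Nat.sum_antidiagonal_succ, hd0,
      Finset.Nat.sum_antidiagonal_eq_sum_range_succ_mk] at h
    simp only [neg_mul, Finset.sum_neg_distrib]
    simp at h
    linarith
  have hnn : ∀ k, 0 ≤ -d (k + 1) := nonneg_of_renewal hc hratio hren
  have hle : ∀ k, -d (k + 1) ≤ c (k + 1) := by
    intro k
    rw [← hren k]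
    have := Finset.single_le_sum (f := fun j => -d (j + 1) * c (k - j))
      (fun j _ => mul_nonneg (hnn j) (hc _).le) (Finset.self_mem_range_succ k)
    simpa [h0] using this
  have habs : ∀ k, |d k| ≤ c k := by
    rintro (_ | k)
    · simp [hd0, h0]
    · rw [abs_of_nonpos (by linarith [hnn k])]
      exact hle k
  refine ⟨fun k => -d (k + 1), hnn, fun t ht => ?_⟩
  have hs := hsum ‖t‖ (norm_nonneg t) ht
  have hcs : Summable fun k : ℕ => ‖(c k : ℂ) * t ^ k‖ := by
    simpa [abs_of_pos (hc _)] using hs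
  have hds : Summable fun k : ℕ => ‖(d k : ℂ) * t ^ k‖ := by
    refine Summable.of_nonneg_of_le (fun _ => norm_nonneg _) (fun k => ?_) hs
    rw [norm_mul, norm_pow, Complex.norm_real, Real.norm_eq_abs]
    gcongr
    exact habs k
  have hds' := hds.of_norm
  have hshift := (summable_nat_add_iff 1).mpr hds'
  refine ⟨by simpa using hshift.neg, ?_⟩
  have h1 : 1 - ∑' k : ℕ, ((-d (k + 1) : ℝ) : ℂ) * t ^ (k + 1) = ∑' k : ℕ, (d k : ℂ) * t ^ k := by
    rw [hds'.tsum_eq_zero_add]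
    simp [hd0, tsum_neg]
  rw [h1, tsum_mul_tsum_eq_tsum_sum_antidiagonal_of_summable_norm hds hcs]
  have h2 : ∀ n, ∑ p ∈ Finset.HasAntidiagonal.antidiagonal n, (d p.1 : ℂ) * t ^ p.1 * ((c p.2 : ℂ) * t ^ p.2) =
      if n = 0 then 1 else 0 := by
    intro n
    have h := congrArg (fun x : ℝ => (x : ℂ) * t ^ n) (hd n)
    simp only [Complex.ofReal_sum, Complex.ofReal_mul, Finset.sum_mul] at h
    calc _ = _ := Finset.sum_congr rfl fun p hp => by
          rw [← Finset.HasAntidiagonal.mem_antidiagonal.mp hp, pow_add]; ring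
      _ = _ := h
      _ = _ := by split_ifs with hn <;> simp [hn]
  simp [h2]

theorem norm_mul_conj_lt_one {z w : ℂ} (hz : z ∈ Metric.ball (0 : ℂ) 1)
    (hw : w ∈ Metric.ball (0 : ℂ) 1) : ‖z * (starRingEnd ℂ) w‖ < 1 := by
  rw [mem_ball_zero_iff] at hz hw
  rw [norm_mul, RCLike.norm_conj]
  exact mul_lt_one_of_nonneg_of_lt_one_left (norm_nonneg z) hz hw.le

/-- A power series in `z * conj w` with nonnegative coefficients is a positive semidefinite
kernel. -/
theorem sum_conj_mul_tsum_nonneg {ι : Type*} [Fintype ι] {e : ℕ → ℝ} (he : ∀ k, 0 ≤ e k)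
    (z ξ : ι → ℂ)
    (hs : ∀ i j, Summable fun k : ℕ => (e k : ℂ) * (z i * (starRingEnd ℂ) (z j)) ^ (k + 1)) :
    0 ≤ ∑ i, ∑ j, (starRingEnd ℂ) (ξ i) * ξ j *
      ∑' k : ℕ, (e k : ℂ) * (z i * (starRingEnd ℂ) (z j)) ^ (k + 1) := by
  have h := hasSum_sum fun i (_ : i ∈ Finset.univ) => hasSum_sum fun j (_ : j ∈ Finset.univ) =>
    (hs i j).hasSum.mul_left ((starRingEnd ℂ) (ξ i) * ξ j)
  refine h.nonneg fun k => ?_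
  have hk : ∑ i, ∑ j, (starRingEnd ℂ) (ξ i) * ξ j *
      ((e k : ℂ) * (z i * (starRingEnd ℂ) (z j)) ^ (k + 1)) =
      e k * (star (∑ j, ξ j * (starRingEnd ℂ) (z j) ^ (k + 1)) *
        ∑ j, ξ j * (starRingEnd ℂ) (z j) ^ (k + 1)) := by
    rw [star_sum, Finset.sum_mul_sum, Finset.mul_sum]
    refine Finset.sum_congr rfl fun i _ => ?_
    rw [Finset.mul_sum]
    refine Finset.sum_congr rfl fun j _ => ?_
    simp only [star_mul', star_pow, RCLike.star_def, Complex.conj_conj, mul_pow]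
    ring
  rw [hk]
  exact mul_nonneg (by exact_mod_cast he k) (star_mul_self_nonneg _)



/-- **Kaluza's lemma.** Let `(c_k)` be reals with `c₀ = 1`, `c_k > 0` for
`k ≥ 1`, and `c_k/c_{k−1} ≤ c_{k+1}/c_k` for `k ≥ 1`, such that `∑ c_k r^k < ∞` for all
`0 ≤ r < 1`. Then the kernel `K(z,w) = ∑_k c_k z^k (conj w)^k` is nowhere zero on `𝔻 × 𝔻`
and `1 − 1/K` is positive semidefinite on `𝔻`. -/
theorem kaluza_complete_pick (c : ℕ → ℝ) (h0 : c 0 = 1) (hpos : ∀ k : ℕ, 0 < c (k + 1))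
    (hratio : ∀ k : ℕ, c (k + 1) / c k ≤ c (k + 2) / c (k + 1))
    (hsum : ∀ r : ℝ, 0 ≤ r → r < 1 → Summable fun k : ℕ => c k * r ^ k) :
    (∀ z ∈ Metric.ball (0 : ℂ) 1, ∀ w ∈ Metric.ball (0 : ℂ) 1,
      (∑' k : ℕ, (c k : ℂ) * z ^ k * (starRingEnd ℂ) w ^ k) ≠ 0) ∧
    (∀ (N : ℕ) (z : Fin N → ℂ), (∀ i, z i ∈ Metric.ball (0 : ℂ) 1) → ∀ ξ : Fin N → ℂ,
      0 ≤ ∑ i : Fin N, ∑ j : Fin N, (starRingEnd ℂ) (ξ i) * ξ j *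
        (1 - 1 / ∑' k : ℕ, (c k : ℂ) * z i ^ k * (starRingEnd ℂ) (z j) ^ k)) := by
  have hc : ∀ k, 0 < c k := by
    rintro (_ | k)
    · simp [h0]
    · exact hpos k
  obtain ⟨e, he, hrec⟩ := exists_nonneg_reciprocal h0 hc hratio hsum
  have hK : ∀ z w : ℂ, ∑' k : ℕ, (c k : ℂ) * z ^ k * (starRingEnd ℂ) w ^ k =
      ∑' k : ℕ, (c k : ℂ) * (z * (starRingEnd ℂ) w) ^ k := by
    simp [mul_pow, mul_assoc]
  refine ⟨fun z hz w hw => ?_, fun N z hz ξ => ?_⟩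
  · rw [hK]
    exact right_ne_zero_of_mul_eq_one (hrec _ (norm_mul_conj_lt_one hz hw)).2
  · have hinv : ∀ i j, 1 - 1 / ∑' k : ℕ, (c k : ℂ) * z i ^ k * (starRingEnd ℂ) (z j) ^ k =
        ∑' k : ℕ, (e k : ℂ) * (z i * (starRingEnd ℂ) (z j)) ^ (k + 1) := by
      intro i j
      rw [hK, one_div, ← eq_inv_of_mul_eq_one_left
        (hrec _ (norm_mul_conj_lt_one (hz i) (hz j))).2, sub_sub_cancel]
    simp only [hinv]
    exact sum_conj_mul_tsum_nonneg he z ξ fun i j =>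
      (hrec _ (norm_mul_conj_lt_one (hz i) (hz j))).1
end

section
/- Let X be a set and let H be a Hilbert space whose elements are functions X → ℂ (with pointwise operations) such that for every x ∈ X the evaluation f ↦ f(x) is a bounded linear functional on H. Let M(H) = {φ : X → ℂ : φ·f ∈ H for all f ∈ H} be the multiplier algebra, assume M(H) ⊆ H and that M(H) is dense in H. Then for every φ ∈ M(H) and f ∈ H, the product φ·f is multiplier-cyclic in H if and only if both φ and f are multiplier-cyclic in H. -/
/-- `φ : X → ℂ` is a multiplier of the function space represented by
`val : H →ₗ[ℂ] (X → ℂ)`: multiplication by `φ` maps the space into itself. -/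
def IsMultiplier {X : Type*} {H : Type*} [NormedAddCommGroup H] [InnerProductSpace ℂ H]
    (val : H →ₗ[ℂ] (X → ℂ)) (φ : X → ℂ) : Prop :=
  ∀ f : H, ∃ g : H, val g = fun x => φ x * val f x

/-- `f ∈ H` is multiplier-cyclic: the multiplier multiples of `f` are dense in `H`. -/
def MultiplierCyclic {X : Type*} {H : Type*} [NormedAddCommGroup H]
    [InnerProductSpace ℂ H] (val : H →ₗ[ℂ] (X → ℂ)) (f : H) : Prop :=
  closure {g : H | ∃ φ : X → ℂ, IsMultiplier val φ ∧ val g = fun x => φ x * val f x} =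
    (Set.univ : Set H)

/-- A multiplier of a space with bounded point evaluations acts as a bounded operator. -/
theorem IsMultiplier.exists_continuousLinearMap {X H : Type*} [NormedAddCommGroup H]
    [InnerProductSpace ℂ H] [CompleteSpace H] {val : H →ₗ[ℂ] (X → ℂ)}
    (hinj : Function.Injective val)
    (heval : ∀ x : X, ∃ L : H →L[ℂ] ℂ, ∀ f : H, L f = val f x)
    {φ : X → ℂ} (hφ : IsMultiplier val φ) :
    ∃ T : H →L[ℂ] H, ∀ f : H, val (T f) = fun x => φ x * val f x := by
  choose m hm using hφ
  let T : H →ₗ[ℂ] H :=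
    { toFun := m
      map_add' := fun f g => hinj <| by
        ext x
        simp [hm, mul_add]
      map_smul' := fun c f => hinj <| by
        ext x
        simp [hm, mul_left_comm] }
  have hval (x : X) : Continuous fun f => val f x := by
    obtain ⟨L, hL⟩ := heval x
    simpa only [← hL] using L.continuous
  refine ⟨ContinuousLinearMap.ofSeqClosedGraph (g := T) fun u f g hu hTu => hinj ?_, hm⟩
  ext x
  have h₁ := ((hval x).tendsto g).comp hTu
  have h₂ := (((hval x).tendsto f).comp hu).const_mul (φ x)
  have h₃ : val (T f) x = φ x * val f x := congrFun (hm f) x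
  rw [h₃]
  refine tendsto_nhds_unique h₁ (h₂.congr fun n => ?_)
  exact (congrFun (hm (u n)) x).symm

/-- Products of multipliers are multipliers. -/
theorem IsMultiplier.mul {X H : Type*} [NormedAddCommGroup H] [InnerProductSpace ℂ H]
    {val : H →ₗ[ℂ] (X → ℂ)} {φ ψ : X → ℂ} (hφ : IsMultiplier val φ)
    (hψ : IsMultiplier val ψ) : IsMultiplier val fun x => φ x * ψ x := by
  intro f
  obtain ⟨g, hg⟩ := hψ f
  obtain ⟨h, hh⟩ := hφ g
  exact ⟨h, by simp only [hh, hg, mul_assoc]⟩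

/-- Let `H` be a reproducing kernel Hilbert space of functions on `X`
(realized by an injective linear map `val` with bounded point evaluations), whose
multiplier algebra `M(H)` is contained in `H` and dense in `H`. Then for `φ ∈ M(H)` and
`f ∈ H`, the product `φ·f` is multiplier-cyclic iff both `φ` and `f` are. -/
theorem multiplierCyclic_mul_iff (X : Type*) (H : Type*) [NormedAddCommGroup H]
    [InnerProductSpace ℂ H] [CompleteSpace H]
    (val : H →ₗ[ℂ] (X → ℂ)) (hinj : Function.Injective val)
    (heval : ∀ x : X, ∃ L : H →L[ℂ] ℂ, ∀ f : H, L f = val f x)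
    (hsub : ∀ φ : X → ℂ, IsMultiplier val φ → ∃ h : H, val h = φ)
    (hdense : Dense {h : H | IsMultiplier val (val h)})
    (φ : X → ℂ) (hφ : IsMultiplier val φ) (hφH : H) (hφHval : val hφH = φ)
    (f : H) (pf : H) (hpf : val pf = fun x => φ x * val f x) :
    MultiplierCyclic val pf ↔ MultiplierCyclic val hφH ∧ MultiplierCyclic val f := by
  obtain ⟨T, hT⟩ := hφ.exists_continuousLinearMap hinj heval
  simp only [MultiplierCyclic, ← dense_iff_closure_eq]
  constructor
  · intro h
    constructor
    · have hrange : DenseRange T := h.mono <| by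
        rintro g ⟨ψ, hψ, hg⟩
        obtain ⟨k, hk⟩ := hψ f
        refine ⟨k, hinj ?_⟩
        simp only [hT, hk, hg, hpf, mul_left_comm]
      refine (hrange.dense_image T.continuous hdense).mono ?_
      rintro _ ⟨k, hk, rfl⟩
      refine ⟨val k, hk, ?_⟩
      simp only [hT, hφHval, mul_comm]
    · refine h.mono ?_
      rintro g ⟨ψ, hψ, hg⟩
      refine ⟨_, hψ.mul hφ, ?_⟩
      simp only [hg, hpf, mul_assoc]
  · rintro ⟨h, hf⟩
    have hrange : DenseRange T := h.mono <| by
      rintro g ⟨ψ, hψ, hg⟩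
      obtain ⟨k, hk⟩ := hsub ψ hψ
      refine ⟨k, hinj ?_⟩
      simp only [hT, hk, hg, hφHval, mul_comm]
    refine (hrange.dense_image T.continuous hf).mono ?_
    rintro _ ⟨k, ⟨ψ, hψ, hk⟩, rfl⟩
    refine ⟨ψ, hψ, ?_⟩
    simp only [hT, hk, hpf, mul_left_comm]
end

section
/- Let X be a Banach space of analytic functions on an open set Ω ⊆ ℂ^d, and let Ω_max be its maximal domain. Then a point w = (w₁,…,w_d) ∈ ℂ^d belongs to Ω_max if and only if S[z₁ − w₁, …, z_d − w_d] ≠ X, where S[z₁ − w₁, …, z_d − w_d] denotes the closed linear span in X of the union S[z₁ − w₁] ∪ ⋯ ∪ S[z_d − w_d]. -/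
/-- The maximal domain `Ω_max` of `X`: the set of points `w ∈ ℂ^d` such that the
functional `P ↦ P(w)`, defined on the (dense set of) polynomials, extends to a bounded
linear functional on `X`. -/
def MaxDomain {d : ℕ} (Ω : Set (Fin d → ℂ)) {X : Type*} [NormedAddCommGroup X]
    [NormedSpace ℂ X] [CompleteSpace X] (val : X →ₗ[ℂ] ((Fin d → ℂ) → ℂ)) :
    Set (Fin d → ℂ) :=
  {w | ∃ L : X →L[ℂ] ℂ, ∀ (P : MvPolynomial (Fin d) ℂ) (p : X),
    Set.EqOn (val p) (fun u => MvPolynomial.eval u P) Ω → L p = MvPolynomial.eval w P}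

/-- A point outside the closure of a subspace is separated from it by a bounded functional. -/
theorem exists_continuousLinearMap_eq_zero_ne_zero {X : Type*} [NormedAddCommGroup X]
    [NormedSpace ℂ X] (M : Submodule ℂ X) {x : X} (hx : x ∉ M.topologicalClosure) :
    ∃ L : X →L[ℂ] ℂ, (∀ m ∈ M, L m = 0) ∧ L x ≠ 0 := by
  have : IsClosed (M.topologicalClosure : Set X) := M.isClosed_topologicalClosure
  have hne : M.topologicalClosure.mkQL x ≠ 0 := by
    simpa using hx
  obtain ⟨f, hf⟩ := SeparatingDual.exists_ne_zero (R := ℂ) hne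
  refine ⟨f.comp M.topologicalClosure.mkQL, fun m hm => ?_, hf⟩
  have hm0 : M.topologicalClosure.mkQL m = 0 := by
    simpa using M.le_topologicalClosure hm
  rw [ContinuousLinearMap.comp_apply, hm0, map_zero]

/-- A polynomial minus its value at `w` lies in the span of the polynomial multiples of the
functions `z_j - w_j`. -/
theorem IsBanachSpaceOfAnalyticFunctions.sub_eval_smul_mem_span {d : ℕ} {Ω : Set (Fin d → ℂ)}
    {X : Type*} [NormedAddCommGroup X] [NormedSpace ℂ X] [CompleteSpace X]
    {val : X →ₗ[ℂ] ((Fin d → ℂ) → ℂ)} (hX : IsBanachSpaceOfAnalyticFunctions d Ω X val)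
    (w : Fin d → ℂ) {e : X} (he : Set.EqOn (val e) (fun _ => 1) Ω)
    (P : MvPolynomial (Fin d) ℂ) (p : X)
    (hp : Set.EqOn (val p) (fun u => MvPolynomial.eval u P) Ω) :
    p - MvPolynomial.eval w P • e ∈ Submodule.span ℂ
      {g : X | ∃ (j : Fin d) (P : MvPolynomial (Fin d) ℂ),
        Set.EqOn (val g) (fun u => MvPolynomial.eval u P * (u j - w j)) Ω} := by
  induction P using MvPolynomial.induction_on generalizing p with
  | C a =>
    have hpe : p = a • e := hX.eqOn_inj _ _ fun u hu => by
      simp [hp hu, he hu]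
    simp [hpe]
  | add P Q ihP ihQ =>
    obtain ⟨q, hq⟩ := hX.poly_mem P
    obtain ⟨r, hr⟩ := hX.poly_mem Q
    have hpqr : p = q + r := hX.eqOn_inj _ _ fun u hu => by
      simp [hp hu, hq hu, hr hu]
    have hsum := Submodule.add_mem _ (ihP q hq) (ihQ r hr)
    convert hsum using 1
    rw [hpqr, map_add, add_smul]
    abel
  | mul_X P j ih =>
    obtain ⟨q, hq⟩ := hX.poly_mem P
    have hmul : p - w j • q ∈ Submodule.span ℂ
        {g : X | ∃ (j : Fin d) (P : MvPolynomial (Fin d) ℂ),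
          Set.EqOn (val g) (fun u => MvPolynomial.eval u P * (u j - w j)) Ω} := by
      refine Submodule.subset_span ⟨j, P, fun u hu => ?_⟩
      simp only [map_sub, map_smul, Pi.sub_apply, Pi.smul_apply, hp hu, hq hu, map_mul,
        MvPolynomial.eval_X, smul_eq_mul]
      ring
    have hsum := Submodule.add_mem _ hmul (Submodule.smul_mem _ (w j) (ih q hq))
    convert hsum using 1
    rw [map_mul, MvPolynomial.eval_X, smul_sub, smul_smul, mul_comm (w j)]
    abel

/-- A point `w ∈ ℂ^d` belongs to the maximal domain of `X` iff
`S[z₁ − w₁, …, z_d − w_d]`, the closed linear span of the polynomial multiples of the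
functions `z_j − w_j`, is not all of `X`. -/
theorem mem_maxDomain_iff (d : ℕ) (hd : 0 < d) (Ω : Set (Fin d → ℂ)) (hΩ : IsOpen Ω)
    (X : Type*) [NormedAddCommGroup X] [NormedSpace ℂ X] [CompleteSpace X]
    (val : X →ₗ[ℂ] ((Fin d → ℂ) → ℂ))
    (hX : IsBanachSpaceOfAnalyticFunctions d Ω X val) (w : Fin d → ℂ) :
    w ∈ MaxDomain Ω val ↔
      closure (↑(Submodule.span ℂ {g : X | ∃ (j : Fin d) (P : MvPolynomial (Fin d) ℂ),
        Set.EqOn (val g) (fun u => MvPolynomial.eval u P * (u j - w j)) Ω}) : Set X) ≠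
      (Set.univ : Set X) := by
  set M := Submodule.span ℂ {g : X | ∃ (j : Fin d) (P : MvPolynomial (Fin d) ℂ),
    Set.EqOn (val g) (fun u => MvPolynomial.eval u P * (u j - w j)) Ω}
  obtain ⟨e, he⟩ := hX.poly_mem 1
  constructor
  · rintro ⟨L, hL⟩ huniv
    have hle : M ≤ LinearMap.ker L.toLinearMap := by
      refine Submodule.span_le.2 ?_
      rintro g ⟨j, P, hg⟩
      have hLg := hL (P * (MvPolynomial.X j - MvPolynomial.C (w j))) g
        fun u hu => by simp [hg hu]
      simpa using hLg
    have hcl : closure (M : Set X) ⊆ {x | L x = 0} :=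
      closure_minimal (fun x hx => hle hx) (isClosed_eq L.continuous continuous_const)
    have hLe0 : L e = 0 := hcl (huniv ▸ Set.mem_univ e)
    have hLe1 : L e = 1 := by simpa using hL 1 e he
    exact one_ne_zero (hLe1.symm.trans hLe0)
  · intro hne
    obtain ⟨x, hx⟩ := (Set.ne_univ_iff_exists_notMem _).1 hne
    obtain ⟨L, hLM, hLx⟩ := exists_continuousLinearMap_eq_zero_ne_zero M (x := x) hx
    have hLp : ∀ (P : MvPolynomial (Fin d) ℂ) (p : X),
        Set.EqOn (val p) (fun u => MvPolynomial.eval u P) Ω →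
          L p = MvPolynomial.eval w P * L e := by
      intro P p hp
      have hmem := hLM _ (hX.sub_eval_smul_mem_span w (e := e) (fun u hu => by simp [he hu]) P p hp)
      simpa [sub_eq_zero] using hmem
    have hLe : L e ≠ 0 := by
      intro h0
      have hL0 : (L : X → ℂ) = fun _ => 0 := by
        refine Continuous.ext_on hX.poly_dense L.continuous continuous_const ?_
        rintro p ⟨P, hp⟩
        simp [hLp P p hp, h0]
      exact hLx (congrFun hL0 x)
    refine ⟨(L e)⁻¹ • L, fun P p hp => ?_⟩
    rw [smul_apply, hLp P p hp, smul_eq_mul]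
    field_simp
end

section
/- Let X be a Banach space of analytic functions on an open set Ω ⊆ ℂ (one complex variable), with maximal domain Ω_max. Then a polynomial P ∈ ℂ[z] is shift-cyclic in X if and only if P(w) ≠ 0 for every w ∈ Ω_max. -/
/-- A Banach space of analytic functions on an open set `Ω ⊆ ℂ` (one complex variable):
a complex Banach space `X` whose elements are (identified with, via the injective-on-`Ω`
linear map `val`) holomorphic functions on `Ω`, satisfying (P1) the polynomials belong
to `X` and are dense, (P2) point evaluations at points of `Ω` are bounded linear
functionals, and (P3) the shift operator `f ↦ z · f` maps `X` into itself. -/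
structure IsBanachSpaceOfAnalyticFunctions1 (Ω : Set ℂ) (X : Type*)
    [NormedAddCommGroup X] [NormedSpace ℂ X] [CompleteSpace X]
    (val : X →ₗ[ℂ] (ℂ → ℂ)) : Prop where
  eqOn_inj : ∀ f g : X, Set.EqOn (val f) (val g) Ω → f = g
  holo : ∀ f : X, DifferentiableOn ℂ (val f) Ω
  poly_mem : ∀ P : Polynomial ℂ, ∃ p : X, Set.EqOn (val p) (fun u => P.eval u) Ω
  poly_dense : Dense {p : X | ∃ P : Polynomial ℂ, Set.EqOn (val p) (fun u => P.eval u) Ω}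
  eval_bdd : ∀ w ∈ Ω, ∃ L : X →L[ℂ] ℂ, ∀ f : X, L f = val f w
  shift_mem : ∀ f : X, ∃ g : X, Set.EqOn (val g) (fun u => u * val f u) Ω

/-- `S[f] = X`: the polynomial multiples of `f` are dense in `X`. -/
def ShiftCyclic1 (Ω : Set ℂ) {X : Type*} [NormedAddCommGroup X] [NormedSpace ℂ X]
    [CompleteSpace X] (val : X →ₗ[ℂ] (ℂ → ℂ)) (f : X) : Prop :=
  closure {g : X | ∃ Q : Polynomial ℂ,
    Set.EqOn (val g) (fun u => Q.eval u * val f u) Ω} = Set.univ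

/-- The maximal domain `Ω_max` of `X`: the set of `w ∈ ℂ` such that the functional
`P ↦ P(w)`, defined on the (dense set of) polynomials, extends to a bounded linear
functional on `X`. -/
def MaxDomain1 (Ω : Set ℂ) {X : Type*} [NormedAddCommGroup X] [NormedSpace ℂ X]
    [CompleteSpace X] (val : X →ₗ[ℂ] (ℂ → ℂ)) : Set ℂ :=
  {w | ∃ L : X →L[ℂ] ℂ, ∀ (P : Polynomial ℂ) (p : X),
    Set.EqOn (val p) (fun u => P.eval u) Ω → L p = P.eval w}

/-- A point outside the closure of a subspace is separated from it by a bounded functional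
vanishing on the subspace. -/
lemma Submodule.exists_continuousLinearMap_eq_zero_of_notMem_topologicalClosure {X : Type*}
    [NormedAddCommGroup X] [NormedSpace ℂ X] (M : Submodule ℂ X) {x : X}
    (hx : x ∉ M.topologicalClosure) :
    ∃ L : X →L[ℂ] ℂ, L x ≠ 0 ∧ ∀ y ∈ M, L y = 0 := by
  have : IsClosed (M.topologicalClosure : Set X) := M.isClosed_topologicalClosure
  have hne : ‖M.topologicalClosure.mkQL x‖ ≠ 0 := by
    simpa [Submodule.Quotient.mk_eq_zero] using hx
  obtain ⟨g, -, hg⟩ := exists_dual_vector ℂ _ hne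
  refine ⟨g.comp M.topologicalClosure.mkQL, ?_, fun y hy => ?_⟩
  · rw [ContinuousLinearMap.comp_apply, hg]
    simpa only [ne_eq, RCLike.ofReal_eq_zero] using hne
  · have h0 : M.topologicalClosure.mkQL y = 0 :=
      (Submodule.Quotient.mk_eq_zero _).2 (M.le_topologicalClosure hy)
    rw [ContinuousLinearMap.comp_apply, h0, map_zero]

/-- The shift operator `f ↦ z · f` is a bounded operator. -/
lemma IsBanachSpaceOfAnalyticFunctions1.exists_shift {Ω : Set ℂ} {X : Type*}
    [NormedAddCommGroup X] [NormedSpace ℂ X] [CompleteSpace X] {val : X →ₗ[ℂ] (ℂ → ℂ)}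
    (hX : IsBanachSpaceOfAnalyticFunctions1 Ω X val) :
    ∃ T : X →L[ℂ] X, ∀ f, ∀ u ∈ Ω, val (T f) u = u * val f u := by
  choose S hS using hX.shift_mem
  let S' : X →ₗ[ℂ] X :=
    { toFun := S
      map_add' := fun f g => hX.eqOn_inj _ _ fun u hu => by
        simp [hS _ hu, mul_add]
      map_smul' := fun c f => hX.eqOn_inj _ _ fun u hu => by
        simp [hS _ hu, mul_left_comm] }
  refine ⟨ContinuousLinearMap.ofSeqClosedGraph (g := S') ?_, fun f u hu => hS f hu⟩
  intro x f y hf hy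
  refine hX.eqOn_inj _ _ fun u hu => ?_
  obtain ⟨L, hL⟩ := hX.eval_bdd u hu
  have h1 := (L.continuous.tendsto y).comp hy
  have h2 := ((L.continuous.tendsto f).comp hf).const_mul u
  have h3 : (L ∘ S' ∘ x) = fun n => u * (L ∘ x) n := by
    funext n
    simp only [Function.comp_apply, hL]
    exact hS _ hu
  rw [h3] at h1
  have h4 := tendsto_nhds_unique h1 h2
  rw [hL, hL] at h4
  rw [h4]
  exact (hS f hu).symm

/-- A polynomial in the shift operator acts as multiplication by that polynomial. -/
lemma val_aeval_shift {Ω : Set ℂ} {X : Type*} [NormedAddCommGroup X] [NormedSpace ℂ X]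
    {val : X →ₗ[ℂ] (ℂ → ℂ)} {T : X →L[ℂ] X}
    (hT : ∀ f, ∀ u ∈ Ω, val (T f) u = u * val f u) (Q : Polynomial ℂ) {u : ℂ} (hu : u ∈ Ω) :
    ∀ f : X, val (Polynomial.aeval T Q f) u = Q.eval u * val f u := by
  induction Q using Polynomial.induction_on' with
  | add p q hp hq => intro f; simp [hp, hq, add_mul]
  | monomial n a =>
    induction n with
    | zero => intro f; simp [ContinuousLinearMap.algebraMap_apply]
    | succ n ih =>
      intro f
      have h := ih (T f)
      rw [hT f u hu] at h
      simp only [Polynomial.aeval_monomial, Polynomial.eval_monomial, pow_succ,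
        ← mul_assoc] at h ⊢
      exact h

/-- If `r` is not in the maximal domain, then `z - r` times the space is dense. -/
lemma denseRange_shift_sub_of_notMem_maxDomain {Ω : Set ℂ} {X : Type*} [NormedAddCommGroup X]
    [NormedSpace ℂ X] [CompleteSpace X] {val : X →ₗ[ℂ] (ℂ → ℂ)}
    (hX : IsBanachSpaceOfAnalyticFunctions1 Ω X val) {T : X →L[ℂ] X}
    (hT : ∀ f, ∀ u ∈ Ω, val (T f) u = u * val f u) {r : ℂ} (hr : r ∉ MaxDomain1 Ω val) :
    DenseRange (Polynomial.aeval T (Polynomial.X - Polynomial.C r)) := by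
  set A := Polynomial.aeval T (Polynomial.X - Polynomial.C r) with hA
  by_contra hd
  have hne : A.range.topologicalClosure ≠ ⊤ := fun h =>
    hd (Submodule.dense_iff_topologicalClosure_eq_top.2 h)
  obtain ⟨x, hx⟩ : ∃ x, x ∉ A.range.topologicalClosure := by
    by_contra! h
    exact hne (eq_top_iff.2 fun x _ => h x)
  obtain ⟨L, hLx, hL⟩ := A.range.exists_continuousLinearMap_eq_zero_of_notMem_topologicalClosure hx
  obtain ⟨e, he⟩ := hX.poly_mem 1
  have key (Q : Polynomial ℂ) (q : X) (hq : Set.EqOn (val q) (fun u => Q.eval u) Ω) :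
      L q = Q.eval r * L e := by
    obtain ⟨R, hR⟩ := Polynomial.X_sub_C_dvd_sub_C_eval (a := r) (p := Q)
    have h : q - Q.eval r • e = A (Polynomial.aeval T R e) := by
      refine hX.eqOn_inj _ _ fun u hu => ?_
      have h1 := congrArg (Polynomial.eval u) hR
      rw [hA, val_aeval_shift hT _ hu, val_aeval_shift hT _ hu]
      simp only [Polynomial.eval_sub, Polynomial.eval_C, Polynomial.eval_mul,
        Polynomial.eval_X] at h1
      simp [hq hu, he hu, h1]
    have h0 : L (q - Q.eval r • e) = 0 := by
      rw [h]
      exact hL _ ⟨_, rfl⟩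
    simpa [sub_eq_zero] using h0
  have hLe : L e ≠ 0 := by
    intro h0
    apply hLx
    have : (L : X → ℂ) = fun _ => 0 :=
      L.continuous.ext_on hX.poly_dense continuous_const
        fun q ⟨Q, hq⟩ => by simp [key Q q hq, h0]
    exact congrFun this x
  refine hr ⟨(L e)⁻¹ • L, fun Q q hq => ?_⟩
  simp [key Q q hq]
  field_simp

/-- Multiplication by a nonzero polynomial without zeros in the maximal domain has dense
range. -/
lemma denseRange_aeval_shift {Ω : Set ℂ} {X : Type*} [NormedAddCommGroup X]
    [NormedSpace ℂ X] [CompleteSpace X] {val : X →ₗ[ℂ] (ℂ → ℂ)}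
    (hX : IsBanachSpaceOfAnalyticFunctions1 Ω X val) {T : X →L[ℂ] X}
    (hT : ∀ f, ∀ u ∈ Ω, val (T f) u = u * val f u) {P : Polynomial ℂ} (hP0 : P ≠ 0)
    (hP : ∀ w ∈ MaxDomain1 Ω val, P.eval w ≠ 0) :
    DenseRange (Polynomial.aeval T P) := by
  have hprod : ∀ s : Multiset ℂ, (∀ r ∈ s, r ∉ MaxDomain1 Ω val) →
      DenseRange (Polynomial.aeval T
        (s.map fun r => Polynomial.X - Polynomial.C r).prod) := by
    intro s
    induction s using Multiset.induction with
    | empty => intro _; simpa using denseRange_id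
    | cons a s ih =>
      intro h
      rw [Multiset.map_cons, Multiset.prod_cons, map_mul]
      exact (denseRange_shift_sub_of_notMem_maxDomain hX hT
        (h a (Multiset.mem_cons_self a s))).comp
        (ih fun r hr => h r (Multiset.mem_cons_of_mem hr)) (ContinuousLinearMap.continuous _)
  have hroots := hprod P.roots fun r hr hm => hP r hm (Polynomial.isRoot_of_mem_roots hr)
  rw [(IsAlgClosed.splits P).eq_prod_roots, map_mul]
  have hC : Function.Surjective (Polynomial.aeval T (Polynomial.C P.leadingCoeff)) := fun x =>
    ⟨P.leadingCoeff⁻¹ • x, by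
      simp [ContinuousLinearMap.algebraMap_apply, hP0]⟩
  exact hC.denseRange.comp hroots (ContinuousLinearMap.continuous _)

/-- In a Banach space of analytic functions on an open set `Ω ⊆ ℂ`,
a polynomial `P` is shift-cyclic iff `P(w) ≠ 0` for every `w` in the maximal domain. -/
theorem polynomial_shiftCyclic_iff_ne_zero_on_maxDomain (Ω : Set ℂ) (hΩ : IsOpen Ω)
    (X : Type*) [NormedAddCommGroup X] [NormedSpace ℂ X] [CompleteSpace X]
    (val : X →ₗ[ℂ] (ℂ → ℂ)) (hX : IsBanachSpaceOfAnalyticFunctions1 Ω X val)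
    (P : Polynomial ℂ) (p : X) (hp : Set.EqOn (val p) (fun u => P.eval u) Ω) :
    ShiftCyclic1 Ω val p ↔ ∀ w ∈ MaxDomain1 Ω val, P.eval w ≠ 0 := by
  have mem_of_mem {w : ℂ} (hw : w ∈ Ω) : w ∈ MaxDomain1 Ω val := by
    obtain ⟨L, hL⟩ := hX.eval_bdd w hw
    exact ⟨L, fun Q q hq => by rw [hL, hq hw]⟩
  constructor
  · rintro hc w ⟨L, hL⟩ hw
    have h0 : (L : X → ℂ) = fun _ => 0 := by
      refine L.continuous.ext_on (dense_iff_closure_eq.2 hc) continuous_const ?_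
      rintro g ⟨Q, hg⟩
      have h := hL (Q * P) g fun u hu => by
        simp [hg hu, hp hu]
      simpa [hw] using h
    obtain ⟨e, he⟩ := hX.poly_mem 1
    have h1 := hL 1 e he
    simp [h0] at h1
  · intro hP
    obtain ⟨T, hT⟩ := hX.exists_shift
    by_cases hP0 : P = 0
    · have hΩ' : ∀ u, u ∉ Ω := fun u hu => hP u (mem_of_mem hu) (by simp [hP0])
      refine Set.eq_univ_of_forall fun g => subset_closure ⟨0, fun u hu => (hΩ' u hu).elim⟩
    · refine dense_iff_closure_eq.1
        (((denseRange_aeval_shift hX hT hP0 hP).dense_image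
          (ContinuousLinearMap.continuous _) hX.poly_dense).mono ?_)
      rintro _ ⟨q, ⟨Q, hq⟩, rfl⟩
      refine ⟨Q, fun u hu => ?_⟩
      simp [val_aeval_shift hT _ hu, hq hu, hp hu, mul_comm]
end
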